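/- arXiv:2004.14057 — 7 statements merged into one kernel-verified Lean document; each statement's English description precedes it below -/
import Mathlib

section
/- Let (P_t)_{0≤t≤T} be a deterministic measurable function P : [0,T] → ℝ of bounded variation on [0,T], and assume that ∫_Ω̄ ln(1+|x|) η₀(dx) < ∞. Then there exists η* ∈ Ā(η₀) which maximizes the functional η ↦ ∫₀ᵀ ∫_Ω̄ e^{−ρt} [−P_t x + f_R(t)] η_t(dx) dt over the set Ā(η₀). -/
open MeasureTheory Set Filter
open scoped Classical

noncomputable section

/-- A flow of positive bounded measures on the state space `S`: each `m t` is a finite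
positive measure supported on `S`, `t ↦ m t B` is measurable for every Borel `B`, and
the total mass is integrable on `[0,T]`. -/
def IsMeasFlow (T : ℝ) (S : Set ℝ) (m : ℝ → Measure ℝ) : Prop :=
  (∀ t, IsFiniteMeasure (m t)) ∧
  (∀ t, m t Sᶜ = 0) ∧
  (∀ B : Set ℝ, MeasurableSet B → Measurable fun t => m t B) ∧
  IntegrableOn (fun t => (m t Set.univ).toReal) (Icc 0 T)

/-- The generator `k(θ-x)∂_x + b(x)∂_xx` applied via derivative witnesses. -/
def gen (k θ : ℝ) (b : ℝ → ℝ) (ux uxx : ℝ → ℝ → ℝ) (t x : ℝ) : ℝ :=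
  k * (θ - x) * ux t x + b x * uxx t x

/-- The Fokker–Planck inequality defining admissible flows: for every nonnegative
`C^{1,2}` function `u` on `[0,T] × S` with bounded `∂_t u + L u`, one has
`∫ u(0,·) dm₀ + ∫₀ᵀ ∫ (∂_t u + L u) dm_t dt ≥ 0`. -/
def FPineq (T k θ : ℝ) (b : ℝ → ℝ) (S : Set ℝ) (m₀ : Measure ℝ)
    (m : ℝ → Measure ℝ) : Prop :=
  ∀ u ut ux uxx : ℝ → ℝ → ℝ,
    ContinuousOn (fun p : ℝ × ℝ => u p.1 p.2) (Icc 0 T ×ˢ S) →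
    ContinuousOn (fun p : ℝ × ℝ => ut p.1 p.2) (Icc 0 T ×ˢ S) →
    ContinuousOn (fun p : ℝ × ℝ => ux p.1 p.2) (Icc 0 T ×ˢ S) →
    ContinuousOn (fun p : ℝ × ℝ => uxx p.1 p.2) (Icc 0 T ×ˢ S) →
    (∀ t ∈ Icc (0:ℝ) T, ∀ x ∈ S, HasDerivAt (fun s => u s x) (ut t x) t) →
    (∀ t ∈ Icc (0:ℝ) T, ∀ x ∈ S, HasDerivAt (fun y => u t y) (ux t x) x) →
    (∀ t ∈ Icc (0:ℝ) T, ∀ x ∈ S, HasDerivAt (fun y => ux t y) (uxx t x) x) →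
    (∀ t ∈ Icc (0:ℝ) T, ∀ x ∈ S, 0 ≤ u t x) →
    (∃ M : ℝ, ∀ t ∈ Icc (0:ℝ) T, ∀ x ∈ S, |ut t x + gen k θ b ux uxx t x| ≤ M) →
    0 ≤ (∫ x, u 0 x ∂m₀) +
        ∫ t in Icc (0:ℝ) T, (∫ x, (ut t x + gen k θ b ux uxx t x) ∂(m t))

/-- Admissible flows started from `m₀`. -/
def Admissible (T k θ : ℝ) (b : ℝ → ℝ) (S : Set ℝ) (m₀ : Measure ℝ)
    (m : ℝ → Measure ℝ) : Prop :=
  IsMeasFlow T S m ∧ FPineq T k θ b S m₀ m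

/-- The set `A(ω₀)` of the conventional producers (CIR generator, state space `Ω = [0,∞)`). -/
def AdmC (T k θ δ : ℝ) (ω₀ : Measure ℝ) (ω : ℝ → Measure ℝ) : Prop :=
  Admissible T k θ (fun x => δ ^ 2 * x / 2) (Ici 0) ω₀ ω

/-- The set `Ā(η₀)` of the renewable producers (Jacobi generator, state space `Ω̄ = [0,1]`). -/
def AdmR (T kb θb δb : ℝ) (η₀ : Measure ℝ) (η : ℝ → Measure ℝ) : Prop :=
  Admissible T kb θb (fun x => δb ^ 2 * x * (1 - x) / 2) (Icc 0 1) η₀ η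

/-- The class of test functions. -/
def IsTest (T k θ : ℝ) (b : ℝ → ℝ) (S : Set ℝ) (u ut ux uxx : ℝ → ℝ → ℝ) : Prop :=
    ContinuousOn (fun p : ℝ × ℝ => u p.1 p.2) (Icc 0 T ×ˢ S) ∧
    ContinuousOn (fun p : ℝ × ℝ => ut p.1 p.2) (Icc 0 T ×ˢ S) ∧
    ContinuousOn (fun p : ℝ × ℝ => ux p.1 p.2) (Icc 0 T ×ˢ S) ∧
    ContinuousOn (fun p : ℝ × ℝ => uxx p.1 p.2) (Icc 0 T ×ˢ S) ∧
    (∀ t ∈ Icc (0:ℝ) T, ∀ x ∈ S, HasDerivAt (fun s => u s x) (ut t x) t) ∧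
    (∀ t ∈ Icc (0:ℝ) T, ∀ x ∈ S, HasDerivAt (fun y => u t y) (ux t x) x) ∧
    (∀ t ∈ Icc (0:ℝ) T, ∀ x ∈ S, HasDerivAt (fun y => ux t y) (uxx t x) x) ∧
    (∀ t ∈ Icc (0:ℝ) T, ∀ x ∈ S, 0 ≤ u t x) ∧
    (∃ M : ℝ, ∀ t ∈ Icc (0:ℝ) T, ∀ x ∈ S, |ut t x + gen k θ b ux uxx t x| ≤ M)

lemma fpineq_iff (T k θ : ℝ) (b : ℝ → ℝ) (S : Set ℝ) (m₀ : Measure ℝ) (m : ℝ → Measure ℝ) :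
    FPineq T k θ b S m₀ m ↔ ∀ u ut ux uxx, IsTest T k θ b S u ut ux uxx →
      0 ≤ (∫ x, u 0 x ∂m₀) +
        ∫ t in Icc (0:ℝ) T, (∫ x, (ut t x + gen k θ b ux uxx t x) ∂(m t)) := by
  constructor
  · rintro h u ut ux uxx ⟨h1, h2, h3, h4, h5, h6, h7, h8, h9⟩
    exact h u ut ux uxx h1 h2 h3 h4 h5 h6 h7 h8 h9
  · intro h u ut ux uxx h1 h2 h3 h4 h5 h6 h7 h8 h9
    exact h u ut ux uxx ⟨h1, h2, h3, h4, h5, h6, h7, h8, h9⟩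

open scoped BoundedContinuousFunction NNReal ENNReal Topology ProbabilityTheory in
lemma isTest_time (T k θ : ℝ) (b : ℝ → ℝ) (S : Set ℝ) (ψ : ℝ → ℝ) (hψ : Continuous ψ)
    (h0 : ∀ t, 0 ≤ ψ t) :
    IsTest T k θ b S (fun t _ => ∫ s in t..T, ψ s) (fun t _ => - ψ t) (fun _ _ => 0)
      (fun _ _ => 0) := by
  have hd : ∀ t, HasDerivAt (fun s => ∫ r in s..T, ψ r) (- ψ t) t := fun t =>
    intervalIntegral.integral_hasDerivAt_left (hψ.intervalIntegrable _ _)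
      (hψ.stronglyMeasurableAtFilter _ _) hψ.continuousAt
  have hc : Continuous (fun s => ∫ r in s..T, ψ r) :=
    continuous_iff_continuousAt.2 fun t => (hd t).continuousAt
  refine ⟨?_, ?_, continuousOn_const, continuousOn_const, fun t _ x _ => hd t,
    fun t _ x _ => hasDerivAt_const _ _, fun t _ x _ => hasDerivAt_const _ _, ?_, ?_⟩
  · exact (hc.comp continuous_fst).continuousOn
  · exact (hψ.comp continuous_fst).neg.continuousOn
  · intro t ht x _
    exact intervalIntegral.integral_nonneg ht.2 (fun s _ => h0 s)
  · obtain ⟨M, hM⟩ := (isCompact_Icc (a := (0:ℝ)) (b := T)).exists_bound_of_continuousOn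
      hψ.continuousOn
    refine ⟨M, fun t ht x _ => ?_⟩
    simpa [gen] using hM t ht

open scoped BoundedContinuousFunction NNReal ENNReal Topology ProbabilityTheory in
lemma measure_le_of_forall_bcf (ν ν' : Measure ℝ) [IsFiniteMeasure ν] [IsFiniteMeasure ν']
    (h : ∀ ψ : ℝ →ᵇ ℝ≥0, ∫ t, (ψ t : ℝ) ∂ν ≤ ∫ t, (ψ t : ℝ) ∂ν') : ν ≤ ν' := by
  have hl : ∀ ψ : ℝ →ᵇ ℝ≥0, ∫⁻ t, (ψ t : ℝ≥0∞) ∂ν ≤ ∫⁻ t, (ψ t : ℝ≥0∞) ∂ν' := by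
    intro ψ
    have e : ∀ (m : Measure ℝ) [IsFiniteMeasure m],
        ∫⁻ t, (ψ t : ℝ≥0∞) ∂m = ENNReal.ofReal (∫ t, (ψ t : ℝ) ∂m) := by
      intro m _
      rw [← BoundedContinuousFunction.toReal_lintegral_coe_eq_integral ψ m, ENNReal.ofReal_toReal]
      exact (BoundedContinuousFunction.lintegral_lt_top_of_nnreal m ψ).ne
    rw [e, e]
    exact ENNReal.ofReal_le_ofReal (h ψ)
  rw [Measure.le_iff]
  intro s hs
  rw [hs.measure_eq_iSup_isClosed_of_ne_top (measure_ne_top ν s)]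
  refine iSup₂_le fun F hF => iSup_le fun hFc => ?_
  refine le_trans ?_ (measure_mono (μ := ν') hF)
  exact le_of_tendsto_of_tendsto' (HasOuterApproxClosed.tendsto_lintegral_apprSeq hFc ν)
    (HasOuterApproxClosed.tendsto_lintegral_apprSeq hFc ν') (fun n => hl _)

open scoped BoundedContinuousFunction NNReal ENNReal Topology ProbabilityTheory in
lemma exists_bcf_ext {K : Set (ℝ × ℝ)} (hK : IsCompact K) (g : ℝ × ℝ → ℝ) (hg : ContinuousOn g K) :
    ∃ G : (ℝ × ℝ) →ᵇ ℝ, ∀ p ∈ K, G p = g p := by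
  have : CompactSpace K := isCompact_iff_compactSpace.mp hK
  obtain ⟨G, -, hG⟩ := BoundedContinuousFunction.exists_extension_norm_eq_of_isClosedEmbedding
    (BoundedContinuousFunction.mkOfCompact ⟨K.domRestrict g, hg.domRestrict⟩)
    (Topology.IsClosedEmbedding.subtypeVal hK.isClosed)
  refine ⟨G, fun p hp => ?_⟩
  exact congr_fun hG ⟨p, hp⟩

open scoped BoundedContinuousFunction NNReal ENNReal Topology ProbabilityTheory in
lemma compProd_compl (T : ℝ) (κ : ProbabilityTheory.Kernel ℝ ℝ) [ProbabilityTheory.IsFiniteKernel κ]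
    (hκ : ∀ t, κ t (Icc 0 1)ᶜ = 0) :
    ((volume.restrict (Icc 0 T)) ⊗ₘ κ) (Icc 0 T ×ˢ Icc 0 1)ᶜ = 0 := by
  rw [Measure.compProd_apply (measurableSet_Icc.prod measurableSet_Icc).compl]
  rw [lintegral_eq_zero_iff' (ProbabilityTheory.Kernel.measurable_kernel_prodMk_left
    (measurableSet_Icc.prod measurableSet_Icc).compl).aemeasurable]
  filter_upwards [ae_restrict_mem measurableSet_Icc] with t ht
  refine measure_mono_null ?_ (hκ t)
  intro x hx hx'
  exact hx ⟨ht, hx'⟩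

open scoped BoundedContinuousFunction NNReal ENNReal Topology ProbabilityTheory in
/-- Iterated integral against a flow as an integral against the space-time measure. -/
lemma bridge (T : ℝ) (κ : ProbabilityTheory.Kernel ℝ ℝ) [ProbabilityTheory.IsFiniteKernel κ]
    (hκ : ∀ t, κ t (Icc 0 1)ᶜ = 0) (η : ℝ → Measure ℝ)
    (hη : ∀ᵐ t ∂(volume.restrict (Icc 0 T)), η t = κ t)
    (g : ℝ → ℝ → ℝ) (G : ℝ × ℝ → ℝ)
    (hG : ∀ p ∈ Icc (0:ℝ) T ×ˢ Icc (0:ℝ) 1, G p = g p.1 p.2)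
    (hGi : Integrable G ((volume.restrict (Icc 0 T)) ⊗ₘ κ)) :
    ∫ t in Icc (0:ℝ) T, ∫ x, g t x ∂(η t) = ∫ p, G p ∂((volume.restrict (Icc 0 T)) ⊗ₘ κ) := by
  rw [Measure.integral_compProd hGi]
  refine integral_congr_ae ?_
  filter_upwards [hη, ae_restrict_mem measurableSet_Icc] with t ht hm
  simp only [ht]
  refine integral_congr_ae ?_
  have : ∀ᵐ x ∂(κ t), x ∈ Icc (0:ℝ) 1 := hκ t
  filter_upwards [this] with x hx
  exact (hG (t, x) ⟨hm, hx⟩).symm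

open scoped BoundedContinuousFunction NNReal ENNReal Topology ProbabilityTheory in
/-- Disintegration of a space-time measure. -/
lemma exists_disint (T : ℝ) (C : ℝ≥0) (μ : Measure (ℝ × ℝ)) [IsFiniteMeasure μ]
    (hμ : μ (Icc 0 T ×ˢ Icc 0 1)ᶜ = 0)
    (hle : μ.fst ≤ (C : ℝ≥0∞) • volume.restrict (Icc 0 T)) :
    ∃ κ : ProbabilityTheory.Kernel ℝ ℝ, (∀ t, κ t univ ≤ C) ∧ (∀ t, κ t (Icc 0 1)ᶜ = 0) ∧
      ∃ _ : ProbabilityTheory.IsFiniteKernel κ, (volume.restrict (Icc 0 T)) ⊗ₘ κ = μ := by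
  set lam : Measure ℝ := volume.restrict (Icc 0 T) with hlam
  have hac : μ.fst ≪ lam := by
    intro s hs
    have := hle s
    simpa [hs] using this
  set r := μ.fst.rnDeriv lam with hr
  have hrm : Measurable r := Measure.measurable_rnDeriv _ _
  have hwd : lam.withDensity r = μ.fst := Measure.withDensity_rnDeriv_eq _ _ hac
  have hrC : ∀ᵐ t ∂lam, r t ≤ C := by
    refine ae_le_of_forall_setLIntegral_le_of_sigmaFinite hrm (fun s hs _ => ?_)
    rw [← withDensity_apply _ hs, hwd]
    simpa using hle s
  let η : ℝ → Measure ℝ := fun t => (min (r t) C) • (μ.condKernel t).restrict (Icc 0 1)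
  have hηm : Measurable η := by
    refine Measure.measurable_of_measurable_coe _ (fun s hs => ?_)
    simp only [η, Measure.smul_apply, smul_eq_mul, Measure.restrict_apply hs]
    exact (hrm.min measurable_const).mul
      (ProbabilityTheory.Kernel.measurable_coe _ (hs.inter measurableSet_Icc))
  let κ : ProbabilityTheory.Kernel ℝ ℝ := ⟨η, hηm⟩
  have hκ : ∀ t, κ t = (min (r t) C) • (μ.condKernel t).restrict (Icc 0 1) := fun t => rfl
  have hmass : ∀ t, κ t univ ≤ C := by
    intro t
    rw [hκ, Measure.smul_apply, smul_eq_mul]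
    calc _ ≤ (C : ℝ≥0∞) * 1 := by
          gcongr
          · exact min_le_right _ _
          · rw [Measure.restrict_apply_univ]; exact prob_le_one
      _ = C := mul_one _
  have hfk : ProbabilityTheory.IsFiniteKernel κ := ⟨⟨C, ENNReal.coe_lt_top, hmass⟩⟩
  refine ⟨κ, hmass, ?_, hfk, ?_⟩
  · intro t
    rw [hκ, Measure.smul_apply, Measure.restrict_apply measurableSet_Icc.compl]
    simp
  · ext s hs
    have hs' : MeasurableSet (s ∩ univ ×ˢ Icc (0:ℝ) 1) :=
      hs.inter (MeasurableSet.univ.prod measurableSet_Icc)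
    have e2 : μ s = μ (s ∩ univ ×ˢ Icc (0:ℝ) 1) := by
      have : ∀ᵐ p ∂μ, p ∈ Icc (0:ℝ) T ×ˢ Icc (0:ℝ) 1 := hμ
      refine measure_congr ?_
      filter_upwards [this] with p hp
      refine propext ⟨fun h => ⟨h, mem_univ _, hp.2⟩, fun h => h.1⟩
    have e3 : μ (s ∩ univ ×ˢ Icc (0:ℝ) 1) =
        ∫⁻ t, μ.condKernel t (Prod.mk t ⁻¹' (s ∩ univ ×ˢ Icc (0:ℝ) 1)) ∂μ.fst := by
      conv_lhs => rw [← μ.disintegrate μ.condKernel]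
      rw [Measure.compProd_apply hs']
    rw [e2, e3, Measure.compProd_apply hs, ← hwd, lintegral_withDensity_eq_lintegral_mul _ hrm
      (ProbabilityTheory.Kernel.measurable_kernel_prodMk_left hs')]
    refine lintegral_congr_ae ?_
    filter_upwards [hrC] with t ht
    rw [hκ, Measure.smul_apply, smul_eq_mul, min_eq_left ht, 
      Measure.restrict_apply (measurable_prodMk_left hs)]
    simp only [Pi.mul_apply]
    congr 2
    ext x
    simp

open scoped BoundedContinuousFunction NNReal ENNReal Topology ProbabilityTheory in
/-- The Fokker-Planck inequality for a space-time measure. -/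
def FPm (T k θ : ℝ) (b : ℝ → ℝ) (m₀ : Measure ℝ) (μ : Measure (ℝ × ℝ)) : Prop :=
  ∀ u ut ux uxx, IsTest T k θ b (Icc 0 1) u ut ux uxx → ∀ G : (ℝ × ℝ) →ᵇ ℝ,
    (∀ p ∈ Icc (0:ℝ) T ×ˢ Icc (0:ℝ) 1, G p = ut p.1 p.2 + gen k θ b ux uxx p.1 p.2) →
    0 ≤ (∫ x, u 0 x ∂m₀) + ∫ p, G p ∂μ

lemma time_integral_const (T : ℝ) (hT : 0 < T) (m₀ : Measure ℝ) (ψ : ℝ → ℝ) :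
    ∫ _x : ℝ, (∫ s in (0:ℝ)..T, ψ s) ∂m₀ = m₀.real univ * ∫ s in Icc (0:ℝ) T, ψ s := by
  rw [integral_const, smul_eq_mul, intervalIntegral.integral_of_le hT.le,
    integral_Icc_eq_integral_Ioc]

open scoped BoundedContinuousFunction NNReal ENNReal Topology ProbabilityTheory in
lemma fpm_marginal (T k θ : ℝ) (hT : 0 < T) (b : ℝ → ℝ) (m₀ : Measure ℝ) (C : ℝ≥0)
    (hC : (C : ℝ≥0∞) = m₀ univ) (μ : Measure (ℝ × ℝ)) [IsFiniteMeasure μ]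
    (hμ : μ (Icc 0 T ×ˢ Icc 0 1)ᶜ = 0) (h : FPm T k θ b m₀ μ) :
    μ.fst ≤ (C : ℝ≥0∞) • volume.restrict (Icc 0 T) := by
  have hfin : IsFiniteMeasure ((C : ℝ≥0∞) • volume.restrict (Icc 0 T)) :=
    ⟨by
      rw [Measure.smul_apply, smul_eq_mul]
      exact ENNReal.mul_lt_top ENNReal.coe_lt_top (measure_lt_top _ _)⟩
  refine measure_le_of_forall_bcf _ _ (fun ψ => ?_)
  have hψc : Continuous (fun t => (ψ t : ℝ)) := by fun_prop
  have htest := isTest_time T k θ b (Icc 0 1) (fun t => (ψ t : ℝ)) hψc (fun t => (ψ t).2)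
  obtain ⟨G, hG⟩ := exists_bcf_ext (K := Icc (0:ℝ) T ×ˢ Icc (0:ℝ) 1)
    (isCompact_Icc.prod isCompact_Icc) (fun p => - (ψ p.1 : ℝ))
    (by fun_prop)
  have h1 := h _ _ _ _ htest G (fun p hp => by rw [hG p hp]; simp [gen])
  have h2 : ∫ p, G p ∂μ = - ∫ t, (ψ t : ℝ) ∂μ.fst := by
    rw [Measure.fst, integral_map measurable_fst.aemeasurable
      hψc.aestronglyMeasurable, ← integral_neg]
    refine integral_congr_ae ?_
    have : ∀ᵐ p ∂μ, p ∈ Icc (0:ℝ) T ×ˢ Icc (0:ℝ) 1 := hμ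
    filter_upwards [this] with p hp using hG p hp
  rw [time_integral_const T hT, h2] at h1
  rw [integral_smul_measure]
  have : m₀.real univ = (C : ℝ) := by rw [Measure.real, ← hC]; simp
  rw [this] at h1
  simp only [ENNReal.coe_toReal, smul_eq_mul]
  linarith

open scoped BoundedContinuousFunction NNReal ENNReal Topology ProbabilityTheory in
lemma flow_mass_le (T k θ : ℝ) (hT : 0 < T) (b : ℝ → ℝ) (m₀ : Measure ℝ) (C : ℝ≥0)
    (hC : (C : ℝ≥0∞) = m₀ univ) (η : ℝ → Measure ℝ) (h : Admissible T k θ b (Icc 0 1) m₀ η) :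
    ∀ᵐ t ∂(volume.restrict (Icc 0 T)), η t univ ≤ C := by
  obtain ⟨⟨hf, hs, hm, hi⟩, hfp⟩ := h
  have hfin : IsFiniteMeasure ((C : ℝ≥0∞) • volume.restrict (Icc 0 T)) :=
    ⟨by
      rw [Measure.smul_apply, smul_eq_mul]
      exact ENNReal.mul_lt_top ENNReal.coe_lt_top (measure_lt_top _ _)⟩
  have hmu : Measurable fun t => η t univ := hm univ MeasurableSet.univ
  have hlt : ∀ t, η t univ < ∞ := fun t => (hf t).measure_univ_lt_top
  have hfin2 : IsFiniteMeasure ((volume.restrict (Icc 0 T)).withDensity fun t => η t univ) := by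
    refine isFiniteMeasure_withDensity ?_
    have := hi.lintegral_lt_top
    simp only [ENNReal.ofReal_toReal (hlt _).ne] at this
    exact this.ne
  have hle : (volume.restrict (Icc 0 T)).withDensity (fun t => η t univ) ≤
      (C : ℝ≥0∞) • volume.restrict (Icc 0 T) := by
    refine measure_le_of_forall_bcf _ _ (fun ψ => ?_)
    have hψc : Continuous (fun t => (ψ t : ℝ)) := by fun_prop
    have htest := isTest_time T k θ b (Icc 0 1) (fun t => (ψ t : ℝ)) hψc (fun t => (ψ t).2)
    have h1 := (fpineq_iff _ _ _ _ _ _ _).1 hfp _ _ _ _ htest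
    rw [time_integral_const T hT] at h1
    have : m₀.real univ = (C : ℝ) := by rw [Measure.real, ← hC]; simp
    rw [this] at h1
    rw [integral_smul_measure, integral_withDensity_eq_integral_toReal_smul hmu
      (Eventually.of_forall hlt)]
    simp only [ENNReal.coe_toReal, smul_eq_mul]
    simp only [gen, mul_zero, add_zero, integral_const, smul_eq_mul, mul_neg, integral_neg,
      Measure.real] at h1
    linarith
  refine ae_le_of_forall_setLIntegral_le_of_sigmaFinite hmu (fun s hs _ => ?_)
  rw [← withDensity_apply _ hs]
  simpa using hle s

open scoped BoundedContinuousFunction NNReal ENNReal Topology ProbabilityTheory in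
lemma integrable_of_bdd_on {μ : Measure (ℝ × ℝ)} [IsFiniteMeasure μ] {K : Set (ℝ × ℝ)}
    (hμ : μ Kᶜ = 0) (h : ℝ × ℝ → ℝ) (hm : Measurable h) (M : ℝ) (hM : ∀ p ∈ K, |h p| ≤ M) :
    Integrable h μ := by
  refine Integrable.of_bound hm.aestronglyMeasurable M ?_
  have : ∀ᵐ p ∂μ, p ∈ K := hμ
  filter_upwards [this] with p hp using hM p hp

open scoped BoundedContinuousFunction NNReal ENNReal Topology ProbabilityTheory in
lemma functional_approx (T : ℝ) (C : ℝ≥0) (ρ : ℝ) (hρ : 0 < ρ) (P f : ℝ → ℝ) (hP : Measurable P)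
    (hPi : Integrable P (volume.restrict (Icc 0 T)))
    (hf : Continuous f) (M : ℝ)
    (hM : ∀ p ∈ Icc (0:ℝ) T ×ˢ Icc (0:ℝ) 1, |Real.exp (-ρ * p.1) * (-(P p.1) * p.2 + f p.1)| ≤ M)
    (ε : ℝ) (hε : 0 < ε) :
    ∃ G : (ℝ × ℝ) →ᵇ ℝ, ∀ μ : Measure (ℝ × ℝ), IsFiniteMeasure μ →
      μ (Icc 0 T ×ˢ Icc 0 1)ᶜ = 0 → μ.fst ≤ (C : ℝ≥0∞) • volume.restrict (Icc 0 T) →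
      |∫ p, Real.exp (-ρ * p.1) * (-(P p.1) * p.2 + f p.1) ∂μ - ∫ p, G p ∂μ| < ε := by
  have hCp : (0:ℝ) < C + 1 := by positivity
  obtain ⟨Q, hQ, -⟩ := hPi.exists_boundedContinuous_integral_sub_le
    (ε := ε / (C + 1) / 2) (by positivity)
  obtain ⟨G, hG⟩ := exists_bcf_ext (K := Icc (0:ℝ) T ×ˢ Icc (0:ℝ) 1)
    (isCompact_Icc.prod isCompact_Icc)
    (fun p => Real.exp (-ρ * p.1) * (-(Q p.1) * p.2 + f p.1)) (by fun_prop)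
  refine ⟨G, fun μ _ hμ hle => ?_⟩
  have hmem : ∀ᵐ p ∂μ, p ∈ Icc (0:ℝ) T ×ˢ Icc (0:ℝ) 1 := hμ
  have hhi : Integrable (fun p : ℝ × ℝ => Real.exp (-ρ * p.1) * (-(P p.1) * p.2 + f p.1)) μ :=
    integrable_of_bdd_on hμ _ (by fun_prop) M hM
  rw [← integral_sub hhi (G.integrable μ)]
  have hQi : Integrable (fun t => ‖P t - Q t‖) (volume.restrict (Icc 0 T)) :=
    (hPi.sub (Q.integrable _)).norm
  have hQi' : Integrable (fun t => ‖P t - Q t‖) ((C : ℝ≥0∞) • volume.restrict (Icc 0 T)) :=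
    hQi.smul_measure (by simp)
  have hQf : Integrable (fun t => ‖P t - Q t‖) μ.fst := hQi'.mono_measure hle
  have hQf2 : Integrable (fun p : ℝ × ℝ => ‖P p.1 - Q p.1‖) μ := hQf.comp_measurable measurable_fst
  calc |∫ p, (Real.exp (-ρ * p.1) * (-(P p.1) * p.2 + f p.1) - G p) ∂μ|
      ≤ ∫ p, ‖P p.1 - Q p.1‖ ∂μ := by
        rw [← Real.norm_eq_abs]
        refine norm_integral_le_of_norm_le hQf2 ?_
        filter_upwards [hmem] with p hp
        rw [hG p hp, show Real.exp (-ρ * p.1) * (-(P p.1) * p.2 + f p.1) -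
          Real.exp (-ρ * p.1) * (-(Q p.1) * p.2 + f p.1) =
          -(Real.exp (-ρ * p.1) * p.2) * (P p.1 - Q p.1) by ring, norm_mul, norm_neg]
        refine mul_le_of_le_one_left (norm_nonneg _) ?_
        have e1 : Real.exp (-ρ * p.1) ≤ 1 := by
          rw [Real.exp_le_one_iff]; nlinarith [hp.1.1]
        rw [Real.norm_of_nonneg (mul_nonneg (Real.exp_pos _).le hp.2.1)]
        exact mul_le_one₀ e1 hp.2.1 hp.2.2
    _ = ∫ t, ‖P t - Q t‖ ∂μ.fst := by
        rw [Measure.fst, integral_map measurable_fst.aemeasurable]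
        exact hQf.aestronglyMeasurable
    _ ≤ ∫ t, ‖P t - Q t‖ ∂((C : ℝ≥0∞) • volume.restrict (Icc 0 T)) :=
        integral_mono_measure hle (Eventually.of_forall fun t => norm_nonneg _) hQi'
    _ = C * ∫ t in Icc (0:ℝ) T, ‖P t - Q t‖ := by
        rw [integral_smul_measure]; simp
    _ ≤ C * (ε / (C + 1) / 2) := by gcongr
    _ < ε := by
        have : (C + 1) * (ε / (C + 1) / 2) = ε / 2 := by field_simp
        have h3 : 0 < ε / (C + 1) / 2 := by positivity
        nlinarith

/-- existence of a maximizer of the relaxed optimal stopping problem of an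
individual renewable producer, for a fixed price trajectory of bounded variation. -/
theorem exists_best_response_renewable
    (T : ℝ) (hT : 0 < T)
    (kb θb δb : ℝ) (hkb : 0 < kb) (hθb : θb ∈ Ioo (0:ℝ) 1) (hδb : 0 < δb)
    (ρ : ℝ) (hρ : 0 < ρ)
    (κR KR γR : ℝ) (hκR : 0 ≤ κR) (hKR : 0 ≤ KR) (hγR : 0 ≤ γR)
    (fR : ℝ → ℝ)
    (hfR : ∀ t, fR t = κR + ρ * KR + γR * KR * Real.exp (-(ρ + γR) * (T - t)))
    (η₀ : Measure ℝ) (hη₀fin : IsFiniteMeasure η₀) (hη₀supp : η₀ (Icc (0:ℝ) 1)ᶜ = 0)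
    (hη₀log : Integrable (fun x => Real.log (1 + |x|)) η₀)
    (P : ℝ → ℝ) (hPmeas : Measurable P) (hPbv : BoundedVariationOn P (Icc 0 T)) :
    ∃ ηs, AdmR T kb θb δb η₀ ηs ∧ ∀ η, AdmR T kb θb δb η₀ η →
      (∫ t in Icc (0:ℝ) T, Real.exp (-ρ * t) * ∫ x, (-(P t) * x + fR t) ∂(η t)) ≤
      (∫ t in Icc (0:ℝ) T, Real.exp (-ρ * t) * ∫ x, (-(P t) * x + fR t) ∂(ηs t)) := by
  set b : ℝ → ℝ := fun x => δb ^ 2 * x * (1 - x) / 2 with hb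
  have hbc : Continuous b := by fun_prop
  set K : Set (ℝ × ℝ) := Icc (0:ℝ) T ×ˢ Icc (0:ℝ) 1 with hKdef
  have hK : IsCompact K := isCompact_Icc.prod isCompact_Icc
  set lam : Measure ℝ := volume.restrict (Icc 0 T) with hlam
  obtain ⟨C, hC⟩ : ∃ C : NNReal, (C : ENNReal) = η₀ univ :=
    ⟨(η₀ univ).toNNReal, ENNReal.coe_toNNReal (measure_ne_top _ _)⟩
  have hfc : Continuous fR := by
    rw [show fR = _ from funext hfR]; fun_prop
  obtain ⟨MP, hMP⟩ : ∃ MP, ∀ t ∈ Icc (0:ℝ) T, |P t| ≤ MP := by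
    refine ⟨(eVariationOn P (Icc 0 T)).toReal + |P 0|, fun t ht => ?_⟩
    have h1 := hPbv.dist_le ht (show (0:ℝ) ∈ Icc 0 T from ⟨le_rfl, hT.le⟩)
    rw [Real.dist_eq] at h1
    have h2 := abs_add_le (P t - P 0) (P 0)
    rw [sub_add_cancel] at h2
    linarith
  have hPi : Integrable P lam := by
    refine Integrable.of_bound hPmeas.aestronglyMeasurable MP ?_
    filter_upwards [ae_restrict_mem measurableSet_Icc] with t ht using hMP t ht
  obtain ⟨Mf, hMf⟩ := (isCompact_Icc (a := (0:ℝ)) (b := T)).exists_bound_of_continuousOn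
      hfc.continuousOn
  set h : ℝ × ℝ → ℝ := fun p => Real.exp (-ρ * p.1) * (-(P p.1) * p.2 + fR p.1) with hh
  have hhm : Measurable h := by
    have := hfc.measurable
    fun_prop
  have hM : ∀ p ∈ K, |h p| ≤ MP + Mf := by
    intro p hp
    have e1 : Real.exp (-ρ * p.1) ≤ 1 := by
      rw [Real.exp_le_one_iff]; nlinarith [hp.1.1]
    rw [hh, abs_mul, abs_of_pos (Real.exp_pos _)]
    refine (mul_le_of_le_one_left (abs_nonneg _) e1).trans ?_
    refine (abs_add_le _ _).trans (add_le_add ?_ (hMf _ hp.1))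
    rw [abs_mul, abs_neg, abs_of_nonneg hp.2.1]
    exact (mul_le_of_le_one_right (abs_nonneg _) hp.2.2).trans (hMP _ hp.1)
  have hgen : ∀ u ut ux uxx, IsTest T kb θb b (Icc 0 1) u ut ux uxx →
      ∃ G : BoundedContinuousFunction (ℝ × ℝ) ℝ,
        ∀ p ∈ K, G p = ut p.1 p.2 + gen kb θb b ux uxx p.1 p.2 := by
    rintro u ut ux uxx ⟨-, h2, h3, h4, -⟩
    refine exists_bcf_ext hK (fun p => ut p.1 p.2 + gen kb θb b ux uxx p.1 p.2) ?_
    refine h2.add (ContinuousOn.add (ContinuousOn.mul ?_ h3) (ContinuousOn.mul ?_ h4))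
    · fun_prop
    · exact (hbc.comp continuous_snd).continuousOn
  -- the compact set of space-time measures
  let S : Set (FiniteMeasure (ℝ × ℝ)) :=
    {μ | μ.mass ≤ C * T.toNNReal ∧ μ Kᶜ = 0} ∩ {μ | FPm T kb θb b η₀ (μ : Measure (ℝ × ℝ))}
  have hclosed : IsClosed {μ : FiniteMeasure (ℝ × ℝ) | FPm T kb θb b η₀ (μ : Measure (ℝ × ℝ))} := by
    simp only [FPm, ofPred_forall]
    refine isClosed_iInter fun u => isClosed_iInter fun ut => isClosed_iInter fun ux =>
      isClosed_iInter fun uxx => isClosed_iInter fun _ => isClosed_iInter fun G =>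
      isClosed_iInter fun _ => ?_
    exact isClosed_le continuous_const (continuous_const.add
      (FiniteMeasure.continuous_integral_boundedContinuousFunction G))
  have hScomp : IsCompact S :=
    (isCompact_setOfPred_finiteMeasure_le_of_isCompact _ hK).inter_right hclosed
  have hSne : S.Nonempty := by
    refine ⟨0, ⟨by simp, by simp⟩, ?_⟩
    rintro u ut ux uxx ⟨-, -, -, -, -, -, -, h8, -⟩ G -
    have : 0 ≤ ∫ x, u 0 x ∂η₀ := by
      refine integral_nonneg_of_ae ?_
      have : ∀ᵐ x ∂η₀, x ∈ Icc (0:ℝ) 1 := hη₀supp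
      filter_upwards [this] with x hx using h8 0 ⟨le_rfl, hT.le⟩ x hx
    simpa using this
  have hSK : ∀ μ ∈ S, (μ : Measure (ℝ × ℝ)) Kᶜ = 0 := fun μ hμ =>
    (FiniteMeasure.null_iff_toMeasure_null _ _).1 hμ.1.2
  have hSm : ∀ μ ∈ S, (μ : Measure (ℝ × ℝ)).fst ≤ (C : ENNReal) • lam := fun μ hμ =>
    fpm_marginal T kb θb hT b η₀ C hC _ (hSK μ hμ) hμ.2
  have hJ : ContinuousOn (fun μ : FiniteMeasure (ℝ × ℝ) => ∫ p, h p ∂(μ : Measure (ℝ × ℝ))) S := by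
    refine continuousOn_of_uniform_approx_of_continuousOn fun v hv => ?_
    obtain ⟨ε, hε, hv⟩ := Metric.mem_uniformity_dist.1 hv
    obtain ⟨G, hG⟩ := functional_approx T C ρ hρ P fR hPmeas hPi hfc _ hM ε hε
    refine ⟨fun μ => ∫ p, G p ∂(μ : Measure (ℝ × ℝ)),
      (FiniteMeasure.continuous_integral_boundedContinuousFunction G).continuousOn,
      fun μ hμ => hv ?_⟩
    rw [Real.dist_eq]
    exact hG μ inferInstance (hSK μ hμ) (hSm μ hμ)
  obtain ⟨μs, hμs, hmax⟩ := hScomp.exists_isMaxOn hSne hJ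
  obtain ⟨κ, hκC, hκs, hκf, hκμ⟩ := exists_disint T C (μs : Measure (ℝ × ℝ)) (hSK _ hμs)
    (hSm _ hμs)
  -- the value of a flow
  have hval : ∀ (κ : ProbabilityTheory.Kernel ℝ ℝ) [ProbabilityTheory.IsFiniteKernel κ],
      (∀ t, κ t (Icc 0 1)ᶜ = 0) → ∀ η : ℝ → Measure ℝ, (∀ᵐ t ∂lam, η t = κ t) →
      (∫ t in Icc (0:ℝ) T, Real.exp (-ρ * t) * ∫ x, (-(P t) * x + fR t) ∂(η t)) =
        ∫ p, h p ∂(lam.compProd κ) := by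
    intro κ _ hκ η hη
    rw [← bridge T κ hκ η hη (fun t x => Real.exp (-ρ * t) * (-(P t) * x + fR t)) h
      (fun p _ => rfl) (integrable_of_bdd_on (compProd_compl T κ hκ) h hhm _ hM)]
    simp only [integral_const_mul]
  refine ⟨κ, ⟨⟨fun t => inferInstance, hκs,
    fun B hB => ProbabilityTheory.Kernel.measurable_coe _ hB, ?_⟩, ?_⟩, ?_⟩
  · refine Integrable.of_bound
      (ProbabilityTheory.Kernel.measurable_coe κ MeasurableSet.univ).ennreal_toReal.aestronglyMeasurable
      (C : ℝ) (Eventually.of_forall fun t => ?_)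
    rw [Real.norm_of_nonneg ENNReal.toReal_nonneg]
    exact ENNReal.toReal_mono (by simp) (hκC t)
  · rw [fpineq_iff]
    intro u ut ux uxx htest
    obtain ⟨G, hG⟩ := hgen u ut ux uxx htest
    rw [bridge T κ hκs κ (Eventually.of_forall fun _ => rfl) _ G hG (G.integrable _), hκμ]
    exact hμs.2 u ut ux uxx htest G hG
  · intro η hη
    have hmass := flow_mass_le T kb θb hT b η₀ C hC η hη
    obtain ⟨⟨hf, hs, hm, hi⟩, hfp⟩ := hη
    have hηm : Measurable η := Measure.measurable_of_measurable_coe _ hm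
    have hset : MeasurableSet {t | η t univ ≤ C} :=
      measurableSet_le (hm univ MeasurableSet.univ) measurable_const
    let κ' : ProbabilityTheory.Kernel ℝ ℝ :=
      ⟨fun t => if η t univ ≤ C then η t else 0, Measurable.ite hset hηm measurable_const⟩
    have hκ' : ∀ t, κ' t = if η t univ ≤ C then η t else 0 := fun t => rfl
    have hκ'C : ∀ t, κ' t univ ≤ C := by
      intro t
      rw [hκ']
      split_ifs with h
      · exact h
      · simp
    have hfk : ProbabilityTheory.IsFiniteKernel κ' := ⟨⟨C, ENNReal.coe_lt_top, hκ'C⟩⟩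
    have hκ's : ∀ t, κ' t (Icc 0 1)ᶜ = 0 := by
      intro t
      rw [hκ']
      split_ifs with h
      · exact hs t
      · simp
    have hae : ∀ᵐ t ∂lam, η t = κ' t := by
      filter_upwards [hmass] with t ht
      rw [hκ', if_pos ht]
    rw [hval κ' hκ's η hae, hval κ hκs κ (Eventually.of_forall fun _ => rfl), hκμ]
    let μ' : FiniteMeasure (ℝ × ℝ) := ⟨lam.compProd κ', inferInstance⟩
    refine hmax (a := μ') ⟨⟨?_, ?_⟩, ?_⟩
    · rw [← ENNReal.coe_le_coe, FiniteMeasure.ennreal_mass]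
      change (lam.compProd κ') univ ≤ _
      rw [Measure.compProd_apply MeasurableSet.univ]
      calc _ ≤ ∫⁻ _t, (C : ENNReal) ∂lam := lintegral_mono fun t => hκ'C t
        _ = _ := by
          rw [lintegral_const, hlam, Measure.restrict_apply_univ, Real.volume_Icc, sub_zero]
          simp [ENNReal.ofReal]
    · exact (FiniteMeasure.null_iff_toMeasure_null _ _).2 (compProd_compl T κ' hκ's)
    · intro u ut ux uxx htest G hG
      have := (fpineq_iff _ _ _ _ _ _ _).1 hfp u ut ux uxx htest
      rwa [bridge T κ' hκ's η hae _ G hG (G.integrable _)] at this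

end
end

section
/- Assume that the demand function D̄ : [0,T] → ℝ has bounded variation on [0,T]. Let (ωⁿ) be a sequence in A(ω₀) converging weakly to ω* ∈ A(ω₀) and let (ηⁿ) be a sequence in Ā(η₀) converging weakly to η* ∈ Ā(η₀). Then there exists a subsequence (n_q) such that the functions t ↦ P_t(ω^{n_q}_t, η^{n_q}_t) converge to t ↦ P_t(ω*_t, η*_t) in L¹([0,T]). -/
open MeasureTheory Set Filter
open scoped Classical

noncomputable section

/-- The set of admissible prices `{P ≥ 0 : (D - R)₊ ≤ ∫ F(P-x) ω(dx) + F₀(P)}`. -/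
def priceSet (F F₀ : ℝ → ℝ) (D R : ℝ) (ω : Measure ℝ) : Set ℝ :=
  {P : ℝ | 0 ≤ P ∧ max (D - R) 0 ≤ (∫ x, F (P - x) ∂ω) + F₀ P}

/-- The market price: the infimum of admissible prices capped at `Pbar`, with the
convention `inf ∅ = +∞` (so the price equals `Pbar` when the set is empty). -/
def price (F F₀ : ℝ → ℝ) (Pbar D R : ℝ) (ω : Measure ℝ) : ℝ :=
  if (priceSet F F₀ D R ω).Nonempty then min (sInf (priceSet F F₀ D R ω)) Pbar else Pbar

/-- Renewable production `R = ∫ x (η̄ - η)(dx)`. -/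
def Rval (ηbar η : Measure ℝ) : ℝ := (∫ x, x ∂ηbar) - ∫ x, x ∂η

/-- The price trajectory `t ↦ P_t(ω_t, η_t)`. -/
def priceT (F F₀ : ℝ → ℝ) (Pbar : ℝ) (D : ℝ → ℝ) (ηbar ω η : ℝ → Measure ℝ)
    (t : ℝ) : ℝ :=
  price F F₀ Pbar (D t) (Rval (ηbar t) (η t)) (ω t)

/-- Weak convergence of flows of measures: the measures `mⁿ_t(dx) dt` on `[0,T] × ℝ`
converge weakly to `m_t(dx) dt`, tested against bounded continuous functions. -/
def WeakConvFlow (T : ℝ) (mseq : ℕ → ℝ → Measure ℝ) (m : ℝ → Measure ℝ) : Prop :=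
  ∀ φ : ℝ × ℝ → ℝ, Continuous φ → (∃ M, ∀ p, |φ p| ≤ M) →
    Tendsto (fun n => ∫ t in Icc (0:ℝ) T, ∫ x, φ (t, x) ∂(mseq n t)) atTop
      (nhds (∫ t in Icc (0:ℝ) T, ∫ x, φ (t, x) ∂(m t)))

/-! ### Flow lemmas -/

lemma ae_mem_of_supp {S : Set ℝ} {μ : Measure ℝ} (h : μ Sᶜ = 0) : ∀ᵐ x ∂μ, x ∈ S := by
  rw [ae_iff]; exact h

lemma flow_g_integrable {S : Set ℝ} {μ : Measure ℝ} [IsFiniteMeasure μ] (h : μ Sᶜ = 0)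
    {g : ℝ → ℝ} (hg : Continuous g) {A : ℝ} (hA : ∀ x ∈ S, |g x| ≤ A) : Integrable g μ := by
  refine Integrable.of_bound hg.aestronglyMeasurable A ?_
  filter_upwards [ae_mem_of_supp h] with x hx
  exact hA x hx

lemma flow_g_bound {S : Set ℝ} {μ : Measure ℝ} [IsFiniteMeasure μ] (h : μ Sᶜ = 0)
    {g : ℝ → ℝ} {A : ℝ} (hA : ∀ x ∈ S, |g x| ≤ A) :
    |∫ x, g x ∂μ| ≤ A * (μ Set.univ).toReal := by
  have := norm_integral_le_of_norm_le_const (μ := μ) (f := g) (C := A)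
    (by filter_upwards [ae_mem_of_supp h] with x hx; exact hA x hx)
  simpa [Measure.real] using this

lemma flow_integrableOn {T : ℝ} {S : Set ℝ} {m : ℝ → Measure ℝ} (hm : IsMeasFlow T S m)
    {g : ℝ → ℝ} (hg : Continuous g) {A : ℝ} (hA : ∀ x ∈ S, |g x| ≤ A) :
    IntegrableOn (fun t => ∫ x, g x ∂(m t)) (Icc 0 T) := by
  obtain ⟨h1, h2, h3, h4⟩ := hm
  have hmeas : Measurable m := Measure.measurable_of_measurable_coe m h3
  have hG : Measurable (fun t => ∫ x, g x ∂(m t)) := by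
    have : (fun t => ∫ x, g x ∂(m t)) = fun t =>
        (∫⁻ x, ENNReal.ofReal (g x) ∂(m t)).toReal
          - (∫⁻ x, ENNReal.ofReal (-g x) ∂(m t)).toReal := by
      funext t
      have := h1 t
      exact integral_eq_lintegral_pos_part_sub_lintegral_neg_part
        (flow_g_integrable (h2 t) hg hA)
    rw [this]
    have a1 : Measurable fun x => ENNReal.ofReal (g x) := hg.measurable.ennreal_ofReal
    have a2 : Measurable fun x => ENNReal.ofReal (-g x) := hg.neg.measurable.ennreal_ofReal
    exact (((Measure.measurable_lintegral a1).comp hmeas).ennreal_toReal).sub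
      (((Measure.measurable_lintegral a2).comp hmeas).ennreal_toReal)
  refine Integrable.mono' (h4.const_mul A) hG.aestronglyMeasurable ?_
  filter_upwards with t
  have := h1 t
  exact flow_g_bound (h2 t) hA

lemma integrableOn_cont_mul {T : ℝ} {ψ G : ℝ → ℝ} (hψ : Continuous ψ)
    (hG : IntegrableOn G (Icc 0 T)) : IntegrableOn (fun t => ψ t * G t) (Icc 0 T) :=
  hG.continuousOn_mul hψ.continuousOn isCompact_Icc

lemma fp_prod {T k θ : ℝ} {b : ℝ → ℝ} {S : Set ℝ} {m₀ : Measure ℝ} {m : ℝ → Measure ℝ}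
    (hb : Continuous b) (hm : Admissible T k θ b S m₀ m)
    {f f1 f2 : ℝ → ℝ} (hf : ∀ x, HasDerivAt f (f1 x) x) (hf1 : ∀ x, HasDerivAt f1 (f2 x) x)
    (hf2 : Continuous f2) {B A : ℝ} (hB : ∀ x ∈ S, 0 ≤ f x ∧ f x ≤ B)
    (hA : ∀ x ∈ S, |k * (θ - x) * f1 x + b x * f2 x| ≤ A)
    {ψ ψ' : ℝ → ℝ} (hψ : ∀ t, HasDerivAt ψ (ψ' t) t) (hψ' : Continuous ψ')
    (hψ0 : ∀ t ∈ Icc 0 T, 0 ≤ ψ t) :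
    0 ≤ ψ 0 * (∫ x, f x ∂m₀) + (∫ t in Icc 0 T, ψ' t * ∫ x, f x ∂(m t))
      + ∫ t in Icc 0 T, ψ t * ∫ x, (k * (θ - x) * f1 x + b x * f2 x) ∂(m t) := by
  have cψ : Continuous ψ := continuous_iff_continuousAt.2 fun t => (hψ t).continuousAt
  have cf : Continuous f := continuous_iff_continuousAt.2 fun t => (hf t).continuousAt
  have cf1 : Continuous f1 := continuous_iff_continuousAt.2 fun t => (hf1 t).continuousAt
  have cL : Continuous fun x => k * (θ - x) * f1 x + b x * f2 x := by fun_prop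
  have hB' : ∀ x ∈ S, |f x| ≤ B := fun x hx => by
    rw [abs_of_nonneg (hB x hx).1]; exact (hB x hx).2
  obtain ⟨hflow, hFP⟩ := hm
  obtain ⟨C1, hC1⟩ := isCompact_Icc.exists_bound_of_continuousOn (s := Icc 0 T) cψ.continuousOn
  obtain ⟨C2, hC2⟩ := isCompact_Icc.exists_bound_of_continuousOn (s := Icc 0 T) hψ'.continuousOn
  have key := hFP (fun t x => ψ t * f x) (fun t x => ψ' t * f x) (fun t x => ψ t * f1 x)
    (fun t x => ψ t * f2 x) (by fun_prop) (by fun_prop) (by fun_prop) (by fun_prop)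
    (fun t _ x _ => (hψ t).mul_const _) (fun t _ x _ => (hf x).const_mul _)
    (fun t _ x _ => (hf1 x).const_mul _)
    (fun t ht x hx => mul_nonneg (hψ0 t ht) (hB x hx).1)
    ⟨C2 * B + C1 * A, fun t ht x hx => by
      have e : ψ' t * f x + gen k θ b (fun t x => ψ t * f1 x) (fun t x => ψ t * f2 x) t x
        = ψ' t * f x + ψ t * (k * (θ - x) * f1 x + b x * f2 x) := by
        simp only [gen]; ring
      rw [e]
      refine (abs_add_le _ _).trans ?_
      rw [abs_mul, abs_mul]
      have h1 := hC1 t ht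
      have h2 := hC2 t ht
      rw [Real.norm_eq_abs] at h1 h2
      exact add_le_add (mul_le_mul h2 (hB' x hx) (abs_nonneg _) ((abs_nonneg _).trans h2))
        (mul_le_mul h1 (hA x hx) (abs_nonneg _) ((abs_nonneg _).trans h1))⟩
  have i1 := integrableOn_cont_mul hψ' (flow_integrableOn hflow cf hB')
  have i2 := integrableOn_cont_mul cψ (flow_integrableOn hflow cL hA)
  rw [integral_const_mul] at key
  have e2 : ∀ t, (∫ x, (ψ' t * f x
      + gen k θ b (fun t x => ψ t * f1 x) (fun t x => ψ t * f2 x) t x) ∂(m t))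
      = ψ' t * (∫ x, f x ∂(m t))
        + ψ t * ∫ x, (k * (θ - x) * f1 x + b x * f2 x) ∂(m t) := by
    intro t
    have := hflow.1 t
    rw [← integral_const_mul, ← integral_const_mul, ← integral_add]
    · congr 1; funext x; simp only [gen]; ring
    · exact (flow_g_integrable (hflow.2.1 t) cf hB').const_mul _
    · exact (flow_g_integrable (hflow.2.1 t) cL hA).const_mul _
  simp only [e2] at key
  rw [integral_add i1 i2] at key
  linarith

/-- The weak one-sided Lipschitz property. -/
def MonoLike (T K : ℝ) (G : ℝ → ℝ) : Prop :=
  ∀ (ρ σ : ℝ → ℝ) (a b d : ℝ), Continuous ρ → Continuous σ → (∀ y, 0 ≤ ρ y) → (∀ y, 0 ≤ σ y) →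
    0 ≤ a → a ≤ b → b ≤ d → d ≤ T → (∀ y, y ∉ Icc a b → ρ y = 0) → (∀ y, y ∉ Icc b d → σ y = 0) →
    (∫ y in a..b, ρ y) = 1 → (∫ y in b..d, σ y) = 1 →
    (∫ y in Icc 0 T, σ y * G y) ≤ (∫ y in Icc 0 T, ρ y * G y) + K * (d - a)

lemma mass_bound {T k θ : ℝ} {b : ℝ → ℝ} {S : Set ℝ} {m₀ : Measure ℝ} {m : ℝ → Measure ℝ}
    (hT : 0 < T) (hb : Continuous b) (hm : Admissible T k θ b S m₀ m)
    {ψ : ℝ → ℝ} (hψ : Continuous ψ) (hψ0 : ∀ t ∈ Icc 0 T, 0 ≤ ψ t) :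
    (∫ t in Icc 0 T, ψ t * (m t Set.univ).toReal)
      ≤ (m₀ Set.univ).toReal * ∫ t in Icc 0 T, ψ t := by
  have := fp_prod (f := fun _ => 1) (f1 := fun _ => 0) (f2 := fun _ => 0) (B := 1) (A := 0)
    hb hm (fun x => hasDerivAt_const _ _) (fun x => hasDerivAt_const _ _) continuous_const
    (by simp) (by simp) (ψ := fun t => ∫ s in t..T, ψ s) (ψ' := fun t => - ψ t)
    (fun t => by
      exact intervalIntegral.integral_hasDerivAt_left (hψ.intervalIntegrable _ _)
        (hψ.stronglyMeasurableAtFilter _ _) hψ.continuousAt) (by fun_prop)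
    (fun t ht => intervalIntegral.integral_nonneg ht.2
      fun s hs => hψ0 s ⟨ht.1.trans hs.1, hs.2⟩)
  simp only [integral_const, smul_eq_mul, mul_one, mul_zero, add_zero,
    neg_mul, integral_neg, Measure.real] at this
  rw [integral_Icc_eq_integral_Ioc (f := ψ), ← intervalIntegral.integral_of_le hT.le]
  linarith

lemma monoLike_of_adm {T k θ : ℝ} {b : ℝ → ℝ} {S : Set ℝ} {m₀ : Measure ℝ} {m : ℝ → Measure ℝ}
    (hT : 0 < T) (hb : Continuous b) (hm : Admissible T k θ b S m₀ m)
    {f f1 f2 : ℝ → ℝ} (hf : ∀ x, HasDerivAt f (f1 x) x) (hf1 : ∀ x, HasDerivAt f1 (f2 x) x)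
    (hf2 : Continuous f2) {B A : ℝ} (hB : ∀ x ∈ S, 0 ≤ f x ∧ f x ≤ B)
    (hA : ∀ x ∈ S, |k * (θ - x) * f1 x + b x * f2 x| ≤ A) (hA0 : 0 ≤ A) :
    MonoLike T (A * (m₀ Set.univ).toReal) (fun t => ∫ x, f x ∂(m t)) := by
  intro ρ σ a β d cρ cσ ρ0 σ0 ha hab hbd hdT hρ hσ hρ1 hσ1
  have cf : Continuous f := continuous_iff_continuousAt.2 fun t => (hf t).continuousAt
  have cf1 : Continuous f1 := continuous_iff_continuousAt.2 fun t => (hf1 t).continuousAt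
  have cL : Continuous fun x => k * (θ - x) * f1 x + b x * f2 x := by fun_prop
  have hB' : ∀ x ∈ S, |f x| ≤ B := fun x hx => by
    rw [abs_of_nonneg (hB x hx).1]; exact (hB x hx).2
  have iρ : ∀ x y, IntervalIntegrable ρ volume x y := fun x y => cρ.intervalIntegrable _ _
  have iσ : ∀ x y, IntervalIntegrable σ volume x y := fun x y => cσ.intervalIntegrable _ _
  have zρ : ∀ x y, y ≤ a → x ≤ y → ∫ s in x..y, ρ s = 0 := by
    intro x y h1 h2
    rw [intervalIntegral.integral_congr_Ioo_of_le h2 (g := fun _ => (0:ℝ))]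
    · simp
    · intro s hs; exact hρ s (fun h => by linarith [h.1, hs.2])
  have zρ' : ∀ x y, β ≤ x → x ≤ y → ∫ s in x..y, ρ s = 0 := by
    intro x y h1 h2
    rw [intervalIntegral.integral_congr_Ioo_of_le h2 (g := fun _ => (0:ℝ))]
    · simp
    · intro s hs; exact hρ s (fun h => by linarith [h.2, hs.1])
  have zσ : ∀ x y, y ≤ β → x ≤ y → ∫ s in x..y, σ s = 0 := by
    intro x y h1 h2
    rw [intervalIntegral.integral_congr_Ioo_of_le h2 (g := fun _ => (0:ℝ))]
    · simp
    · intro s hs; exact hσ s (fun h => by linarith [h.1, hs.2])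
  have zσ' : ∀ x y, d ≤ x → x ≤ y → ∫ s in x..y, σ s = 0 := by
    intro x y h1 h2
    rw [intervalIntegral.integral_congr_Ioo_of_le h2 (g := fun _ => (0:ℝ))]
    · simp
    · intro s hs; exact hσ s (fun h => by linarith [h.2, hs.1])
  have nρ : ∀ x y, x ≤ y → 0 ≤ ∫ s in x..y, ρ s := fun x y h =>
    intervalIntegral.integral_nonneg h fun s _ => ρ0 s
  have nσ : ∀ x y, x ≤ y → 0 ≤ ∫ s in x..y, σ s := fun x y h =>
    intervalIntegral.integral_nonneg h fun s _ => σ0 s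
  have adρ : ∀ x y z, (∫ s in x..y, ρ s) + (∫ s in y..z, ρ s) = ∫ s in x..z, ρ s :=
    fun x y z => intervalIntegral.integral_add_adjacent_intervals (iρ _ _) (iρ _ _)
  have adσ : ∀ x y z, (∫ s in x..y, σ s) + (∫ s in y..z, σ s) = ∫ s in x..z, σ s :=
    fun x y z => intervalIntegral.integral_add_adjacent_intervals (iσ _ _) (iσ _ _)
  set ψ : ℝ → ℝ := fun t => (∫ s in (0:ℝ)..t, ρ s) - ∫ s in (0:ℝ)..t, σ s with hψdef
  have dψ : ∀ t, HasDerivAt ψ (ρ t - σ t) t := fun t =>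
    ((cρ.integral_hasStrictDerivAt 0 t).hasDerivAt).sub
      ((cσ.integral_hasStrictDerivAt 0 t).hasDerivAt)
  have cψ : Continuous ψ := continuous_iff_continuousAt.2 fun t => (dψ t).continuousAt
  have hψz : ∀ t ∈ Icc 0 T, 0 ≤ ψ t ∧ ψ t ≤ (Icc a d).indicator (fun _ => (1:ℝ)) t := by
    intro t ht
    have h0a := zρ 0 a le_rfl ha
    have h0b := zσ 0 β le_rfl (ha.trans hab)
    by_cases h1 : t < a
    · have := zρ 0 t h1.le ht.1
      have := zσ 0 t (h1.le.trans hab) ht.1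
      rw [indicator_of_notMem (fun h => by linarith [h.1])]
      simp only [hψdef]; constructor <;> linarith
    by_cases h2 : d < t
    · have e1 := adρ 0 a β
      have e2 := adρ 0 β t
      have e3 := zρ' β t le_rfl (by linarith)
      have e4 := adσ 0 β d
      have e5 := adσ 0 d t
      have e6 := zσ' d t le_rfl (by linarith)
      rw [indicator_of_notMem (fun h => by linarith [h.2])]
      simp only [hψdef]; constructor <;> linarith
    push Not at h1 h2
    rw [indicator_of_mem (show t ∈ Icc a d from ⟨h1, h2⟩)]
    by_cases h3 : t ≤ β
    · have e1 := adρ 0 a t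
      have e2 := adρ a t β
      have e3 := nρ a t h1
      have e4 := nρ t β h3
      have e5 := zσ 0 t h3 ht.1
      simp only [hψdef]; constructor <;> linarith
    · push Not at h3
      have e1 := adρ 0 a β
      have e2 := adρ 0 β t
      have e3 := zρ' β t le_rfl h3.le
      have e4 := adσ 0 β t
      have e5 := adσ β t d
      have e6 := nσ β t h3.le
      have e7 := nσ t d h2
      simp only [hψdef]; constructor <;> linarith
  have key := fp_prod hb hm hf hf1 hf2 hB hA dψ (by fun_prop) (fun t ht => (hψz t ht).1)
  have hψ00 : ψ 0 = 0 := by simp [hψdef]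
  have iG := flow_integrableOn hm.1 cf hB'
  have iL := flow_integrableOn hm.1 cL hA
  have e1 : (∫ t in Icc 0 T, (ρ t - σ t) * ∫ x, f x ∂(m t))
      = (∫ t in Icc 0 T, ρ t * ∫ x, f x ∂(m t)) - ∫ t in Icc 0 T, σ t * ∫ x, f x ∂(m t) := by
    rw [← integral_sub (integrableOn_cont_mul cρ iG) (integrableOn_cont_mul cσ iG)]
    congr 1; funext t; ring
  have e2 : (∫ t in Icc 0 T, ψ t * ∫ x, (k * (θ - x) * f1 x + b x * f2 x) ∂(m t))
      ≤ ∫ t in Icc 0 T, A * (ψ t * (m t Set.univ).toReal) := by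
    refine setIntegral_mono_on (integrableOn_cont_mul cψ iL)
      ((integrableOn_cont_mul cψ hm.1.2.2.2).const_mul A) measurableSet_Icc ?_
    intro t ht
    have := hm.1.1 t
    have h1 := (le_abs_self _).trans (flow_g_bound (hm.1.2.1 t) hA)
    have h2 := mul_le_mul_of_nonneg_left h1 (hψz t ht).1
    linarith
  rw [integral_const_mul] at e2
  have e3 := mass_bound hT hb hm cψ (fun t ht => (hψz t ht).1)
  have e4 : (∫ t in Icc 0 T, ψ t) ≤ d - a := by
    have : (∫ t in Icc 0 T, ψ t)
        ≤ ∫ t in Icc 0 T, (Icc a d).indicator (fun _ => (1:ℝ)) t := by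
      refine setIntegral_mono_on (cψ.continuousOn.integrableOn_compact isCompact_Icc)
        ((integrable_const _).indicator measurableSet_Icc) measurableSet_Icc
        (fun t ht => (hψz t ht).2)
    refine this.trans ?_
    rw [setIntegral_indicator measurableSet_Icc, setIntegral_const,
      inter_eq_right.2 (Icc_subset_Icc ha hdT)]
    simp [Real.volume_real_Icc_of_le (hab.trans hbd)]
  have e5 : A * (∫ t in Icc 0 T, ψ t * (m t Set.univ).toReal)
      ≤ A * ((m₀ Set.univ).toReal * (d - a)) :=
    mul_le_mul_of_nonneg_left
      (e3.trans (mul_le_mul_of_nonneg_left e4 ENNReal.toReal_nonneg)) hA0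
  rw [hψ00, e1] at key
  linarith

/-! ### Kernel averages -/

/-- A continuous kernel supported in `[c-r,c+r]`. -/
def pkr (c r y : ℝ) : ℝ := 3 / (4 * r ^ 3) * max 0 (r ^ 2 - (y - c) ^ 2)

lemma ker_cont (c r : ℝ) : Continuous (pkr c r) := by unfold pkr; fun_prop

lemma ker_nonneg (c : ℝ) {r : ℝ} (hr : 0 < r) (y : ℝ) : 0 ≤ pkr c r y := by
  unfold pkr; positivity

lemma ker_le (c : ℝ) {r : ℝ} (hr : 0 < r) (y : ℝ) : pkr c r y ≤ 1 / r := by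
  unfold pkr
  have h : max 0 (r ^ 2 - (y - c) ^ 2) ≤ r ^ 2 :=
    max_le (by positivity) (by nlinarith [sq_nonneg (y - c)])
  calc 3 / (4 * r ^ 3) * max 0 (r ^ 2 - (y - c) ^ 2) ≤ 3 / (4 * r ^ 3) * r ^ 2 :=
        mul_le_mul_of_nonneg_left h (by positivity)
    _ = (3 / 4) * (1 / r) := by field_simp
    _ ≤ 1 / r := by have : 0 < 1 / r := by positivity
                    linarith

lemma ker_supp (c : ℝ) {r : ℝ} (hr : 0 < r) (y : ℝ) (hy : y ∉ Icc (c - r) (c + r)) :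
    pkr c r y = 0 := by
  unfold pkr
  rw [max_eq_left, mul_zero]
  by_contra! h
  apply hy
  have := abs_lt_of_sq_lt_sq (a := y - c) (b := r) (by linarith) hr.le
  rw [abs_lt] at this
  constructor <;> linarith

lemma ker_int (c : ℝ) {r : ℝ} (hr : 0 < r) : ∫ y in (c - r)..(c + r), pkr c r y = 1 := by
  have h1 : ∫ y in (c - r)..(c + r), pkr c r y
      = ∫ y in (c - r)..(c + r), 3 / (4 * r ^ 3) * (r ^ 2 - (y - c) ^ 2) := by
    refine intervalIntegral.integral_congr fun y hy => ?_
    rw [uIcc_of_le (by linarith)] at hy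
    simp only [pkr]
    rw [max_eq_right]
    nlinarith [hy.1, hy.2]
  rw [h1, intervalIntegral.integral_eq_sub_of_hasDerivAt
    (f := fun y => 3 / (4 * r ^ 3) * (r ^ 2 * y - (y - c) ^ 3 / 3))]
  · field_simp; ring
  · intro y _
    have := (((hasDerivAt_id y).const_mul (r ^ 2)).sub
      ((((hasDerivAt_id y).sub_const c).pow 3).div_const 3)).const_mul (3 / (4 * r ^ 3))
    refine this.congr_deriv ?_
    simp only [id]
    push_cast
    ring
  · exact Continuous.intervalIntegrable (by fun_prop) _ _

lemma ker_avg {T : ℝ} {G : ℝ → ℝ} (hG : IntegrableOn G (Icc 0 T)) :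
    ∀ᵐ t, t ∈ Ioo 0 T → ∀ s : ℝ, |s| = 1 →
      Tendsto (fun r => ∫ y in Icc 0 T, pkr (t + s * r) r y * G y) (nhdsWithin 0 (Ioi 0))
        (nhds (G t)) := by
  set f := (Icc 0 T).indicator G with hf
  have fi : Integrable f := hG.integrable_indicator measurableSet_Icc
  filter_upwards [IsUnifLocDoublingMeasure.ae_tendsto_average_norm_sub volume
    fi.locallyIntegrable 1] with t ht htT s hs
  have hft : f t = G t := indicator_of_mem (Ioo_subset_Icc_self htT) _
  have h1 := ht (l := nhdsWithin (0:ℝ) (Ioi 0)) (fun r => t + s * r) (fun r => r) tendsto_id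
    (by
      filter_upwards [self_mem_nhdsWithin] with r hr
      rw [Metric.mem_closedBall, Real.dist_eq, one_mul]
      have : t - (t + s * r) = -(s * r) := by ring
      rw [this, abs_neg, abs_mul, hs, one_mul, abs_of_pos hr])
  have h2 := h1.const_mul 2
  rw [mul_zero] at h2
  rw [tendsto_iff_norm_sub_tendsto_zero]
  refine squeeze_zero' (Eventually.of_forall fun _ => norm_nonneg _) ?_ h2
  filter_upwards [self_mem_nhdsWithin] with r hr
  have hr : 0 < r := hr
  set c := t + s * r with hc
  have e1 : (∫ y in Icc 0 T, pkr c r y * G y) = ∫ y in Icc (c - r) (c + r), pkr c r y * f y := by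
    have a1 : (∫ y in Icc 0 T, pkr c r y * G y) = ∫ y, pkr c r y * f y := by
      rw [← integral_indicator measurableSet_Icc]
      congr 1; funext y
      by_cases hy : y ∈ Icc 0 T <;> simp [hf, hy]
    rw [a1, setIntegral_eq_integral_of_forall_compl_eq_zero]
    intro y hy
    rw [ker_supp c hr y hy, zero_mul]
  have e2 : ∫ y in Icc (c - r) (c + r), pkr c r y * f t = f t := by
    rw [integral_mul_const, integral_Icc_eq_integral_Ioc, ← intervalIntegral.integral_of_le
      (by linarith), ker_int c hr, one_mul]
  have i1 : IntegrableOn (fun y => pkr c r y * f y) (Icc (c - r) (c + r)) :=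
    fi.integrableOn.continuousOn_mul (ker_cont c r).continuousOn isCompact_Icc
  have i2 : IntegrableOn (fun y => pkr c r y * f t) (Icc (c - r) (c + r)) :=
    ((ker_cont c r).mul continuous_const).continuousOn.integrableOn_compact isCompact_Icc
  have i3 : IntegrableOn (fun y => ‖f y - f t‖) (Icc (c - r) (c + r)) :=
    (fi.integrableOn.sub (integrableOn_const (by simp))).norm
  rw [← hft, e1]
  have e3 : (∫ y in Icc (c - r) (c + r), pkr c r y * f y) - f t
      = ∫ y in Icc (c - r) (c + r), (pkr c r y * f y - pkr c r y * f t) := by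
    rw [integral_sub i1 i2, e2]
  rw [e3]
  calc ‖∫ y in Icc (c - r) (c + r), (pkr c r y * f y - pkr c r y * f t)‖
      ≤ ∫ y in Icc (c - r) (c + r), (1 / r) * ‖f y - f t‖ := by
        refine norm_integral_le_of_norm_le (i3.const_mul _) (Eventually.of_forall fun y => ?_)
        rw [← mul_sub, norm_mul, Real.norm_of_nonneg (ker_nonneg c hr y)]
        exact mul_le_mul_of_nonneg_right (ker_le c hr y) (norm_nonneg _)
    _ = 2 * ⨍ y in Metric.closedBall c r, ‖f y - f t‖ := by
        rw [integral_const_mul, setAverage_eq, Real.closedBall_eq_Icc,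
          Real.volume_real_Icc_of_le (by linarith), smul_eq_mul]
        have : c + r - (c - r) = 2 * r := by ring
        rw [this]; field_simp

lemma ae_conv {T K : ℝ} {Gs : ℕ → ℝ → ℝ} {G : ℝ → ℝ}
    (hGs : ∀ n, IntegrableOn (Gs n) (Icc 0 T)) (hG : IntegrableOn G (Icc 0 T))
    (hmono : ∀ n, MonoLike T K (Gs n))
    (hweak : ∀ ρ : ℝ → ℝ, Continuous ρ → (∃ M, ∀ y, |ρ y| ≤ M) →
      Tendsto (fun n => ∫ y in Icc 0 T, ρ y * Gs n y) atTop
        (nhds (∫ y in Icc 0 T, ρ y * G y))) :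
    ∀ᵐ t, t ∈ Ioo 0 T → Tendsto (fun n => Gs n t) atTop (nhds (G t)) := by
  filter_upwards [ker_avg hG, ae_all_iff.2 fun n => ker_avg (hGs n)] with t ht hts htT
  have ht := ht htT
  have hts := fun n => hts n htT
  have h1 : |(1:ℝ)| = 1 := by simp
  have h2 : |(-1:ℝ)| = 1 := by simp
  have small : ∀ ε > (0:ℝ), ∀ᶠ r in nhdsWithin (0:ℝ) (Ioi 0), r < ε := fun ε hε =>
    mem_nhdsWithin_of_mem_nhds (Iio_mem_nhds hε)
  have pos : ∀ᶠ r in nhdsWithin (0:ℝ) (Ioi 0), 0 < r := self_mem_nhdsWithin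
  have mono : ∀ n r r', 0 < r → 0 < r' → 0 ≤ t - 2 * r → t + 2 * r' ≤ T →
      (∫ y in Icc 0 T, pkr (t + 1 * r') r' y * Gs n y)
        ≤ (∫ y in Icc 0 T, pkr (t + (-1) * r) r y * Gs n y) + K * (2 * r + 2 * r') := by
    intro n r r' hr hr' h3 h4
    have := hmono n (pkr (t + (-1) * r) r) (pkr (t + 1 * r') r') (t - 2 * r) t (t + 2 * r')
      (ker_cont _ _) (ker_cont _ _) (ker_nonneg _ hr) (ker_nonneg _ hr') h3 (by linarith)
      (by linarith) h4
      (fun y hy => ker_supp _ hr y (by convert hy using 2; congr 1 <;> ring))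
      (fun y hy => ker_supp _ hr' y (by convert hy using 2; congr 1 <;> ring))
      (by convert ker_int (t + (-1) * r) hr using 2 <;> ring)
      (by convert ker_int (t + 1 * r') hr' using 2 <;> ring)
    convert this using 3
    ring
  have lim2 : Tendsto (fun r : ℝ => 2 * r) (nhdsWithin 0 (Ioi 0)) (nhds 0) := by
    have : Tendsto (fun r : ℝ => 2 * r) (nhds 0) (nhds (2 * 0)) :=
      (continuous_const.mul continuous_id).tendsto 0
    rw [mul_zero] at this
    exact this.mono_left nhdsWithin_le_nhds
  have up : ∀ n r, 0 < r → 0 ≤ t - 2 * r →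
      Gs n t ≤ (∫ y in Icc 0 T, pkr (t + (-1) * r) r y * Gs n y) + K * (2 * r) := by
    intro n r hr h3
    have l2 : Tendsto (fun r' : ℝ => (∫ y in Icc 0 T, pkr (t + (-1) * r) r y * Gs n y)
        + K * (2 * r + 2 * r')) (nhdsWithin 0 (Ioi 0))
        (nhds ((∫ y in Icc 0 T, pkr (t + (-1) * r) r y * Gs n y) + K * (2 * r + 0))) :=
      ((lim2.const_add _).const_mul _).const_add _
    rw [add_zero] at l2
    refine le_of_tendsto_of_tendsto (hts n 1 h1) l2 ?_
    filter_upwards [pos, small ((T - t) / 2) (by linarith [htT.2])] with r' hr' hr2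
    exact mono n r r' hr hr' h3 (by linarith)
  have lo : ∀ n r', 0 < r' → t + 2 * r' ≤ T →
      (∫ y in Icc 0 T, pkr (t + 1 * r') r' y * Gs n y) ≤ Gs n t + K * (2 * r') := by
    intro n r' hr' h3
    have l2 : Tendsto (fun r : ℝ => (∫ y in Icc 0 T, pkr (t + (-1) * r) r y * Gs n y)
        + K * (2 * r + 2 * r')) (nhdsWithin 0 (Ioi 0))
        (nhds (Gs n t + K * (0 + 2 * r'))) :=
      (hts n (-1) h2).add ((lim2.add_const _).const_mul _)
    rw [zero_add] at l2
    refine ge_of_tendsto l2 ?_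
    filter_upwards [pos, small (t / 2) (by linarith [htT.1])] with r hr hr2
    exact mono n r r' hr hr' (by linarith) h3
  rw [Metric.tendsto_atTop']
  intro ε hε
  have klim : Tendsto (fun r : ℝ => K * (2 * r)) (nhdsWithin 0 (Ioi 0)) (nhds 0) := by
    simpa using lim2.const_mul K
  have hε3 : 0 < ε / 3 := by positivity
  obtain ⟨r, hr0, hr1, hr2, hr3, hr4, hr5⟩ := (pos.and ((small (t / 2) (by linarith [htT.1])).and
    ((small ((T - t) / 2) (by linarith [htT.2])).and
    ((klim.eventually (Iio_mem_nhds hε3)).and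
    (((ht 1 h1).eventually (Metric.ball_mem_nhds _ hε3)).and
     ((ht (-1) h2).eventually (Metric.ball_mem_nhds _ hε3))))))).exists
  have kb : ∀ c, ∃ M, ∀ y, |pkr c r y| ≤ M := fun c => ⟨1 / r, fun y => by
    rw [abs_of_nonneg (ker_nonneg c hr0 y)]; exact ker_le c hr0 y⟩
  have w1 := (hweak _ (ker_cont (t + 1 * r) r) (kb _)).eventually (Metric.ball_mem_nhds _ hε3)
  have w2 := (hweak _ (ker_cont (t + (-1) * r) r) (kb _)).eventually
    (Metric.ball_mem_nhds _ hε3)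
  obtain ⟨N, hN⟩ := eventually_atTop.1 (w1.and w2)
  refine ⟨N, fun n hn => ?_⟩
  obtain ⟨g1, g2⟩ := hN n hn.le
  simp only [Real.dist_eq, abs_lt] at g1 g2 hr4 hr5 ⊢
  have u := up n r hr0 (by linarith)
  have l := lo n r hr0 (by linarith)
  constructor <;> linarith

/-! ### Price -/

lemma supply_integrable {F : ℝ → ℝ} (cF : Continuous F) (hFrange : ∀ y, F y ∈ Icc (0:ℝ) 1)
    (ω : Measure ℝ) [IsFiniteMeasure ω] (P : ℝ) : Integrable (fun x => F (P - x)) ω := by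
  refine Integrable.of_bound (by fun_prop) 1 (Eventually.of_forall fun x => ?_)
  rw [Real.norm_of_nonneg (hFrange _).1]; exact (hFrange _).2

lemma price_tendsto {F F₀ : ℝ → ℝ} {c : ℝ} (hc : 0 < c) (cF : Continuous F) (hFmono : Monotone F)
    (hFrange : ∀ y, F y ∈ Icc (0:ℝ) 1) (hF₀zero : F₀ 0 = 0)
    (hF₀slope : ∀ p h : ℝ, 0 ≤ p → 0 ≤ h → c * h ≤ F₀ (p + h) - F₀ p)
    (Pbar D : ℝ) {Rs : ℕ → ℝ} {R : ℝ} (hR : Tendsto Rs atTop (nhds R))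
    {ωn : ℕ → Measure ℝ} {ω : Measure ℝ} (hfin : ∀ n, IsFiniteMeasure (ωn n))
    (hfin' : IsFiniteMeasure ω)
    (hS : ∀ q : ℚ, Tendsto (fun n => ∫ x, F (q - x) ∂(ωn n)) atTop
      (nhds (∫ x, F (q - x) ∂ω))) :
    Tendsto (fun n => price F F₀ Pbar D (Rs n) (ωn n)) atTop (nhds (price F F₀ Pbar D R ω)) := by
  have smono : ∀ (μ : Measure ℝ) [IsFiniteMeasure μ] (p q : ℝ), p ≤ q →
      ∫ x, F (p - x) ∂μ ≤ ∫ x, F (q - x) ∂μ := by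
    intro μ _ p q hpq
    exact integral_mono (supply_integrable cF hFrange μ p) (supply_integrable cF hFrange μ q)
      fun x => hFmono (by linarith)
  have F0slope : ∀ p q, 0 ≤ p → p ≤ q → c * (q - p) ≤ F₀ q - F₀ p := by
    intro p q hp hpq
    have := hF₀slope p (q - p) hp (by linarith)
    rwa [add_sub_cancel] at this
  have F0mono : ∀ p q, 0 ≤ p → p ≤ q → F₀ p ≤ F₀ q := by
    intro p q hp hpq
    have := F0slope p q hp hpq
    nlinarith [mul_nonneg hc.le (sub_nonneg.2 hpq)]
  have ne : ∀ (r : ℝ) (μ : Measure ℝ), (priceSet F F₀ D r μ).Nonempty := by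
    intro r μ
    have hv : 0 ≤ max (D - r) 0 := le_max_right _ _
    refine ⟨max (D - r) 0 / c, by positivity, ?_⟩
    have h1 := F0slope 0 (max (D - r) 0 / c) le_rfl (by positivity)
    rw [hF₀zero, sub_zero, sub_zero, mul_div_cancel₀ _ hc.ne'] at h1
    have h2 : 0 ≤ ∫ x, F (max (D - r) 0 / c - x) ∂μ := integral_nonneg fun x => (hFrange _).1
    linarith
  have bdd : ∀ (r : ℝ) (μ : Measure ℝ), BddBelow (priceSet F F₀ D r μ) :=
    fun r μ => ⟨0, fun P hP => hP.1⟩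
  have hv : Tendsto (fun n => max (D - Rs n) 0) atTop (nhds (max (D - R) 0)) :=
    (hR.const_sub D).max tendsto_const_nhds
  have hH : ∀ q : ℚ, Tendsto (fun n => (∫ x, F (q - x) ∂(ωn n)) + F₀ q) atTop
      (nhds ((∫ x, F (q - x) ∂ω) + F₀ q)) := fun q => (hS q).add_const _
  simp only [price, ne, if_true]
  refine Tendsto.min ?_ tendsto_const_nhds
  rw [tendsto_order]
  constructor
  · intro a ha
    by_cases ha0 : a < 0
    · filter_upwards with n
      exact ha0.trans_le (le_csInf (ne _ _) fun P hP => hP.1)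
    push Not at ha0
    obtain ⟨q, hq1, hq2⟩ := exists_rat_btwn ha
    have hq : (∫ x, F (q - x) ∂ω) + F₀ q < max (D - R) 0 := by
      by_contra! h
      exact notMem_of_lt_csInf hq2 (bdd _ _) ⟨by linarith, h⟩
    filter_upwards [(hH q).eventually_lt hv hq] with n hn
    refine hq1.trans_le (le_csInf (ne _ _) fun P hP => ?_)
    by_contra! h
    have := hfin n
    have h1 := smono (ωn n) P q h.le
    have h2 := F0mono P q hP.1 h.le
    linarith [hP.2]
  · intro a ha
    obtain ⟨q, hq1, hq2⟩ := exists_rat_btwn ha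
    obtain ⟨P, hP, hPq⟩ := exists_lt_of_csInf_lt (ne _ _) hq1
    have hq : max (D - R) 0 < (∫ x, F (q - x) ∂ω) + F₀ q := by
      have h1 := smono ω P q hPq.le
      have h2 := F0slope P q hP.1 hPq.le
      have h3 := mul_pos hc (sub_pos.2 hPq)
      linarith [hP.2]
    filter_upwards [hv.eventually_lt (hH q) hq] with n hn
    exact (csInf_le (bdd _ _) ⟨hP.1.trans hPq.le, hn.le⟩).trans_lt hq2

lemma price_mem {F F₀ : ℝ → ℝ} {Pbar : ℝ} (hP : 0 < Pbar) (D R : ℝ) (ω : Measure ℝ) :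
    0 ≤ price F F₀ Pbar D R ω ∧ price F F₀ Pbar D R ω ≤ Pbar := by
  unfold price
  split_ifs with h
  · exact ⟨le_min (le_csInf h fun P hP => hP.1) hP.le, min_le_right _ _⟩
  · exact ⟨hP.le, le_rfl⟩

lemma supply_ae {T k θ δ : ℝ} (hT : 0 < T) {F : ℝ → ℝ} (hFsm : ContDiff ℝ (⊤ : ℕ∞) F)
    (hFrange : ∀ y, F y ∈ Icc (0:ℝ) 1) (hFneg : ∀ y ≤ (0:ℝ), F y = 0)
    {ω₀ : Measure ℝ} {ωseq : ℕ → ℝ → Measure ℝ} (hωseq : ∀ n, AdmC T k θ δ ω₀ (ωseq n))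
    {ωs : ℝ → Measure ℝ} (hωs : AdmC T k θ δ ω₀ ωs) (hωconv : WeakConvFlow T ωseq ωs) (q : ℝ) :
    ∀ᵐ t, t ∈ Ioo 0 T → Tendsto (fun n => ∫ x, F (q - x) ∂(ωseq n t)) atTop
      (nhds (∫ x, F (q - x) ∂(ωs t))) := by
  have cF : Continuous F := hFsm.continuous
  have h1 : ∀ y, HasDerivAt F (deriv F y) y := fun y =>
    (hFsm.differentiable (by simp) y).hasDerivAt
  have sm1 : ContDiff ℝ (⊤ : ℕ∞) (deriv F) := by
    have := (contDiff_infty_iff_deriv (f := F)).1 hFsm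
    exact this.2
  have sm2 : ContDiff ℝ (⊤ : ℕ∞) (deriv (deriv F)) := by
    have := (contDiff_infty_iff_deriv (f := deriv F)).1 sm1
    exact this.2
  have h2 : ∀ y, HasDerivAt (deriv F) (deriv (deriv F) y) y := fun y =>
    (sm1.differentiable (by simp) y).hasDerivAt
  have c1 := sm1.continuous
  have c2 := sm2.continuous
  have z1 : ∀ y < (0:ℝ), deriv F y = 0 := by
    intro y hy
    have : F =ᶠ[nhds y] fun _ => 0 := by
      filter_upwards [Iio_mem_nhds hy] with z hz using hFneg z (le_of_lt hz)
    rw [this.deriv_eq]; simp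
  have z2 : ∀ y < (0:ℝ), deriv (deriv F) y = 0 := by
    intro y hy
    have : deriv F =ᶠ[nhds y] fun _ => 0 := by
      filter_upwards [Iio_mem_nhds hy] with z hz using z1 z hz
    rw [this.deriv_eq]; simp
  have d1 : ∀ x, HasDerivAt (fun x => F (q - x)) (-deriv F (q - x)) x := by
    intro x
    have := (h1 (q - x)).comp x ((hasDerivAt_id x).const_sub q)
    exact this.congr_deriv (by ring)
  have d2 : ∀ x, HasDerivAt (fun x => -deriv F (q - x)) (deriv (deriv F) (q - x)) x := by
    intro x
    have := ((h2 (q - x)).comp x ((hasDerivAt_id x).const_sub q)).neg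
    exact this.congr_deriv (by ring)
  have cL : Continuous fun x => k * (θ - x) * (-deriv F (q - x))
      + (δ ^ 2 * x / 2) * deriv (deriv F) (q - x) := by fun_prop
  obtain ⟨A, hA⟩ := isCompact_Icc.exists_bound_of_continuousOn (s := Icc 0 q) cL.continuousOn
  have hA' : ∀ x ∈ Ici (0:ℝ), |k * (θ - x) * (-deriv F (q - x))
      + (δ ^ 2 * x / 2) * deriv (deriv F) (q - x)| ≤ max A 0 := by
    intro x hx
    by_cases hxq : x ≤ q
    · exact (hA x ⟨hx, hxq⟩).trans (le_max_left _ _)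
    · push Not at hxq
      rw [z1 _ (by linarith), z2 _ (by linarith)]
      simp
  have hB : ∀ x ∈ Ici (0:ℝ), 0 ≤ F (q - x) ∧ F (q - x) ≤ 1 := fun x _ => hFrange _
  have hB' : ∀ x ∈ Ici (0:ℝ), |F (q - x)| ≤ 1 := fun x _ => by
    rw [abs_of_nonneg (hFrange _).1]; exact (hFrange _).2
  have cb : Continuous fun x : ℝ => δ ^ 2 * x / 2 := by fun_prop
  refine ae_conv (K := max A 0 * (ω₀ Set.univ).toReal)
    (fun n => flow_integrableOn (hωseq n).1 (by fun_prop) hB')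
    (flow_integrableOn hωs.1 (by fun_prop) hB')
    (fun n => monoLike_of_adm hT cb (hωseq n) d1 d2 (by fun_prop) hB hA' (le_max_right _ _)) ?_
  rintro ρ cρ ⟨M, hM⟩
  have := hωconv (fun p => ρ p.1 * F (q - p.2)) (by fun_prop) ⟨M, fun p => by
    rw [abs_mul, abs_of_nonneg (hFrange _).1]
    have h := hM p.1
    exact (mul_le_of_le_one_right (abs_nonneg _) (hFrange _).2).trans h⟩
  simpa only [integral_const_mul] using this

lemma ren_ae {T k θ δ : ℝ} (hT : 0 < T)
    {η₀ : Measure ℝ} {ηseq : ℕ → ℝ → Measure ℝ} (hηseq : ∀ n, AdmR T k θ δ η₀ (ηseq n))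
    {ηs : ℝ → Measure ℝ} (hηs : AdmR T k θ δ η₀ ηs) (hηconv : WeakConvFlow T ηseq ηs) :
    ∀ᵐ t, t ∈ Ioo 0 T → Tendsto (fun n => ∫ x, x ∂(ηseq n t)) atTop
      (nhds (∫ x, x ∂(ηs t))) := by
  have cL : Continuous fun x : ℝ => k * (θ - x) * 1 + (δ ^ 2 * x * (1 - x) / 2) * 0 := by fun_prop
  obtain ⟨A, hA⟩ := isCompact_Icc.exists_bound_of_continuousOn (s := Icc 0 1) cL.continuousOn
  have hA0 : 0 ≤ A := (norm_nonneg _).trans (hA 0 ⟨le_rfl, zero_le_one⟩)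
  have hB : ∀ x ∈ Icc (0:ℝ) 1, 0 ≤ x ∧ x ≤ 1 := fun x h => h
  have hB' : ∀ x ∈ Icc (0:ℝ) 1, |x| ≤ 1 := fun x h => by
    rw [abs_of_nonneg h.1]; exact h.2
  have cb : Continuous fun x : ℝ => δ ^ 2 * x * (1 - x) / 2 := by fun_prop
  refine ae_conv (K := A * (η₀ Set.univ).toReal)
    (fun n => flow_integrableOn (hηseq n).1 continuous_id hB')
    (flow_integrableOn hηs.1 continuous_id hB')
    (fun n => monoLike_of_adm hT cb (hηseq n) (f := fun x => x) (f1 := fun _ => 1)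
      (f2 := fun _ => 0) (fun x => hasDerivAt_id x) (fun x => hasDerivAt_const _ _)
      continuous_const hB hA hA0) ?_
  rintro ρ cρ ⟨M, hM⟩
  have := hηconv (fun p => ρ p.1 * max 0 (min p.2 1)) (by fun_prop) ⟨M, fun p => by
    have h0 : 0 ≤ max 0 (min p.2 1) := le_max_left _ _
    have h1 : max 0 (min p.2 1) ≤ 1 := max_le zero_le_one (min_le_right _ _)
    rw [abs_mul, abs_of_nonneg h0]
    have h := hM p.1
    exact (mul_le_of_le_one_right (abs_nonneg _) h1).trans h⟩
  have e : ∀ μ : Measure ℝ, μ (Icc (0:ℝ) 1)ᶜ = 0 →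
      ∫ x, max 0 (min x 1) ∂μ = ∫ x, x ∂μ := by
    intro μ hμ
    refine integral_congr_ae ?_
    filter_upwards [ae_mem_of_supp hμ] with x hx
    rw [min_eq_left hx.2, max_eq_right hx.1]
  simp only [integral_const_mul] at this
  simpa only [e _ (hηs.1.2.1 _), fun n t => e _ ((hηseq n).1.2.1 t)] using this

/-- Bounded a.e. convergence to zero gives convergence of (Bochner) integrals. -/
lemma tendsto_integral_zero {μ : Measure ℝ} [IsFiniteMeasure μ] {g : ℕ → ℝ → ℝ} {C : ℝ}
    (hg : ∀ n t, |g n t| ≤ C) (h : ∀ᵐ t ∂μ, Tendsto (fun n => g n t) atTop (nhds 0)) :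
    Tendsto (fun n => ∫ t, g n t ∂μ) atTop (nhds 0) := by
  set g' : ℕ → ℝ → ℝ := fun n => if AEStronglyMeasurable (g n) μ then g n else 0 with hg'
  have e : ∀ n, ∫ t, g n t ∂μ = ∫ t, g' n t ∂μ := by
    intro n
    simp only [hg']
    split_ifs with hm
    · rfl
    · rw [integral_undef (fun hi => hm hi.1)]; simp
  simp only [e]
  have hC : 0 ≤ C := (abs_nonneg _).trans (hg 0 0)
  have := tendsto_integral_of_dominated_convergence (μ := μ) (F := g') (f := fun _ => 0)
    (fun _ => C) (fun n => by
      simp only [hg']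
      split_ifs with hm
      · exact hm
      · exact aestronglyMeasurable_zero)
    (integrable_const _)
    (fun n => Eventually.of_forall fun t => by
      simp only [hg']
      split_ifs with hm
      · exact hg n t
      · simpa using hC)
    (by
      filter_upwards [h] with t ht
      refine squeeze_zero_norm (fun n => ?_) (by simpa using ht.norm)
      simp only [hg']
      split_ifs with hm
      · exact le_rfl
      · simp)
  simpa using this

/-- stability of the price trajectory: along weakly converging sequences of
admissible flows, a subsequence of price trajectories converges in `L¹([0,T])`. -/
theorem price_L1_convergence
    (T k θ δ : ℝ) (hT : 0 < T) (hk : 0 < k) (hθ : 0 < θ) (hδ : 0 < δ)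
    (kb θb δb : ℝ) (hkb : 0 < kb) (hθb : θb ∈ Ioo (0:ℝ) 1) (hδb : 0 < δb)
    (F : ℝ → ℝ) (c₁ : ℝ) (hc₁ : 0 < c₁) (hFsm : ContDiff ℝ (⊤ : ℕ∞) F) (hFmono : Monotone F)
    (hFrange : ∀ y, F y ∈ Icc (0:ℝ) 1) (hFneg : ∀ y ≤ (0:ℝ), F y = 0)
    (hFpos : ∀ y > (0:ℝ), 0 < F y) (hFone : ∀ y ≥ c₁, F y = 1)
    (F₀ : ℝ → ℝ) (c : ℝ) (hc : 0 < c) (hF₀zero : F₀ 0 = 0)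
    (hF₀mono : MonotoneOn F₀ (Ici 0))
    (hF₀slope : ∀ p h : ℝ, 0 ≤ p → 0 ≤ h → c * h ≤ F₀ (p + h) - F₀ p)
    (Pbar : ℝ) (hPbar : 0 < Pbar)
    (ηbar₀ : Measure ℝ) (hηbar₀fin : IsFiniteMeasure ηbar₀)
    (hηbar₀supp : ηbar₀ (Icc (0:ℝ) 1)ᶜ = 0)
    (ηbar : ℝ → Measure ℝ) (hηbar : AdmR T kb θb δb ηbar₀ ηbar)
    (D : ℝ → ℝ) (hD : BoundedVariationOn D (Icc 0 T))
    (ω₀ : Measure ℝ) (hω₀fin : IsFiniteMeasure ω₀) (hω₀supp : ω₀ (Ici (0:ℝ))ᶜ = 0)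
    (η₀ : Measure ℝ) (hη₀fin : IsFiniteMeasure η₀) (hη₀supp : η₀ (Icc (0:ℝ) 1)ᶜ = 0)
    (ωseq : ℕ → ℝ → Measure ℝ) (hωseq : ∀ n, AdmC T k θ δ ω₀ (ωseq n))
    (ωs : ℝ → Measure ℝ) (hωs : AdmC T k θ δ ω₀ ωs)
    (hωconv : WeakConvFlow T ωseq ωs)
    (ηseq : ℕ → ℝ → Measure ℝ) (hηseq : ∀ n, AdmR T kb θb δb η₀ (ηseq n))
    (ηs : ℝ → Measure ℝ) (hηs : AdmR T kb θb δb η₀ ηs)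
    (hηconv : WeakConvFlow T ηseq ηs) :
    ∃ φ : ℕ → ℕ, StrictMono φ ∧
      Tendsto (fun q => ∫ t in Icc (0:ℝ) T,
          |priceT F F₀ Pbar D ηbar (ωseq (φ q)) (ηseq (φ q)) t
            - priceT F F₀ Pbar D ηbar ωs ηs t|)
        atTop (nhds 0) := by
  have cF : Continuous F := hFsm.continuous
  refine ⟨id, strictMono_id, ?_⟩
  refine tendsto_integral_zero (C := Pbar) (fun n t => ?_) ?_
  · have h1 := price_mem (F := F) (F₀ := F₀) hPbar (D t) (Rval (ηbar t) (ηseq n t)) (ωseq n t)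
    have h2 := price_mem (F := F) (F₀ := F₀) hPbar (D t) (Rval (ηbar t) (ηs t)) (ωs t)
    simp only [id, priceT, abs_abs, abs_le]
    constructor <;> linarith [h1.1, h1.2, h2.1, h2.2]
  · rw [← restrict_Ioo_eq_restrict_Icc, ae_restrict_iff' measurableSet_Ioo]
    filter_upwards [ren_ae hT hηseq hηs hηconv, ae_all_iff.2 fun q : ℚ =>
      supply_ae hT hFsm hFrange hFneg hωseq hωs hωconv (q : ℝ)] with t h1 h2 ht
    have hR : Tendsto (fun n => Rval (ηbar t) (ηseq n t)) atTop (nhds (Rval (ηbar t) (ηs t))) :=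
      (h1 ht).const_sub _
    have := price_tendsto hc cF hFmono hFrange hF₀zero hF₀slope Pbar (D t) hR
      (fun n => (hωseq n).1.1 t) (hωs.1.1 t) (fun q => h2 q ht)
    rw [tendsto_iff_norm_sub_tendsto_zero] at this
    exact this

end
end

section
/- Let (ω¹, η¹) and (ω², η²) be two Nash equilibria of the relaxed mean-field game. Then the set of times { t ∈ [0,T] : P_t(ω¹_t, η¹_t) ≠ P_t(ω²_t, η²_t) } has Lebesgue measure zero. -/
open MeasureTheory Set Filter
open scoped Classical

noncomputable section

/-- A Nash equilibrium of the relaxed mean-field game: `(ω, η)` are admissible flows and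
no deviation of either population increases the corresponding gain, given the price
trajectory `t ↦ P_t(ω_t, η_t)`. -/
def NashEq (T k θ δ kb θb δb ρ : ℝ) (F F₀ G fC fR : ℝ → ℝ) (Pbar : ℝ)
    (D : ℝ → ℝ) (ω₀ η₀ : Measure ℝ) (ηbar : ℝ → Measure ℝ)
    (ω η : ℝ → Measure ℝ) : Prop :=
  AdmC T k θ δ ω₀ ω ∧ AdmR T kb θb δb η₀ η ∧
  (∀ ω', AdmC T k θ δ ω₀ ω' →
    (∫ t in Icc (0:ℝ) T, Real.exp (-ρ * t) *
      ∫ x, (G (priceT F F₀ Pbar D ηbar ω η t - x) + fC t) ∂(ω' t)) ≤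
    (∫ t in Icc (0:ℝ) T, Real.exp (-ρ * t) *
      ∫ x, (G (priceT F F₀ Pbar D ηbar ω η t - x) + fC t) ∂(ω t))) ∧
  (∀ η', AdmR T kb θb δb η₀ η' →
    (∫ t in Icc (0:ℝ) T, Real.exp (-ρ * t) *
      ∫ x, (-(priceT F F₀ Pbar D ηbar ω η t) * x + fR t) ∂(η' t)) ≤
    (∫ t in Icc (0:ℝ) T, Real.exp (-ρ * t) *
      ∫ x, (-(priceT F F₀ Pbar D ηbar ω η t) * x + fR t) ∂(η t)))


section Helpers

theorem aux_intF {F : ℝ → ℝ} (hFc : Continuous F) (hFrange : ∀ y, F y ∈ Icc (0:ℝ) 1)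
    (ω : Measure ℝ) [IsFiniteMeasure ω] (p : ℝ) : Integrable (fun x => F (p - x)) ω := by
  refine Integrable.of_bound (by fun_prop) 1 (Eventually.of_forall fun x => ?_)
  rw [Real.norm_eq_abs, abs_of_nonneg (hFrange _).1]
  exact (hFrange _).2

theorem aux_up {F F₀ : ℝ → ℝ} (hFc : Continuous F) (hFmono : Monotone F)
    (hFrange : ∀ y, F y ∈ Icc (0:ℝ) 1) (hF₀mono : MonotoneOn F₀ (Ici 0))
    (ω : Measure ℝ) [IsFiniteMeasure ω] {D R p q : ℝ}
    (hp : p ∈ priceSet F F₀ D R ω) (hpq : p ≤ q) : q ∈ priceSet F F₀ D R ω := by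
  refine ⟨hp.1.trans hpq, hp.2.trans (add_le_add ?_ ?_)⟩
  · exact integral_mono (aux_intF hFc hFrange ω p) (aux_intF hFc hFrange ω q)
      (fun x => hFmono (by linarith))
  · exact hF₀mono hp.1 (hp.1.trans hpq) hpq

theorem aux_bdd (F F₀ : ℝ → ℝ) (D R : ℝ) (ω : Measure ℝ) :
    BddBelow (priceSet F F₀ D R ω) := ⟨0, fun _ hp => hp.1⟩

theorem aux_nonneg (F F₀ : ℝ → ℝ) {Pbar : ℝ} (hPbar : 0 < Pbar) (D R : ℝ) (ω : Measure ℝ) :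
    0 ≤ price F F₀ Pbar D R ω := by
  unfold price
  split_ifs with h
  · exact le_min (Real.sInf_nonneg fun _ hp => hp.1) hPbar.le
  · exact hPbar.le

theorem aux_le (F F₀ : ℝ → ℝ) (Pbar : ℝ) (D R : ℝ) (ω : Measure ℝ) :
    price F F₀ Pbar D R ω ≤ Pbar := by
  unfold price
  split_ifs with h
  · exact min_le_right _ _
  · exact le_rfl

theorem aux_lt_iff (F F₀ : ℝ → ℝ) {Pbar a : ℝ} (ha : a ≤ Pbar) (D R : ℝ) (ω : Measure ℝ) :
    price F F₀ Pbar D R ω < a ↔ ∃ p ∈ priceSet F F₀ D R ω, p < a := by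
  unfold price
  split_ifs with h
  · constructor
    · intro h1
      rcases min_lt_iff.1 h1 with h2 | h2
      · exact exists_lt_of_csInf_lt h h2
      · exact absurd h2 (not_lt.2 ha)
    · rintro ⟨p, hp, hpa⟩
      exact (min_le_left _ _).trans_lt ((csInf_le (aux_bdd _ _ _ _ _) hp).trans_lt hpa)
  · constructor
    · intro h1
      exact absurd h1 (not_lt.2 ha)
    · rintro ⟨p, hp, -⟩
      exact absurd ⟨p, hp⟩ h

theorem aux_meas_int {T : ℝ} {S : Set ℝ} {m : ℝ → Measure ℝ} (hm : IsMeasFlow T S m)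
    {f : ℝ → ℝ} (hf : Continuous f) : Measurable fun t => ∫ x, f x ∂(m t) := by
  have h1 : Measurable m := Measure.measurable_of_measurable_coe m hm.2.2.1
  have h2 := StronglyMeasurable.integral_kernel
    (κ := (⟨m, h1⟩ : ProbabilityTheory.Kernel ℝ ℝ)) hf.stronglyMeasurable
  exact h2.measurable

theorem aux_price_meas {F F₀ : ℝ → ℝ} (hFc : Continuous F) (hFmono : Monotone F)
    (hFrange : ∀ y, F y ∈ Icc (0:ℝ) 1) (hF₀mono : MonotoneOn F₀ (Ici 0)) (Pbar : ℝ)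
    {T : ℝ} {S S' : Set ℝ} {D : ℝ → ℝ} (hD : Measurable D) {ηbar ω η : ℝ → Measure ℝ}
    (h1 : IsMeasFlow T S ηbar) (h2 : IsMeasFlow T S' ω) (h3 : IsMeasFlow T S η) :
    Measurable (priceT F F₀ Pbar D ηbar ω η) := by
  refine measurable_of_Iio fun a => ?_
  by_cases ha : a ≤ Pbar
  · have : priceT F F₀ Pbar D ηbar ω η ⁻¹' Iio a = ⋃ q : ℚ, ⋃ _ : (q:ℝ) < a,
        {t | (q:ℝ) ∈ priceSet F F₀ (D t) (Rval (ηbar t) (η t)) (ω t)} := by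
      ext t
      have := h2.1 t
      simp only [mem_preimage, mem_Iio, mem_iUnion, mem_ofPred_eq, exists_prop]
      unfold priceT
      rw [aux_lt_iff F F₀ ha]
      constructor
      · rintro ⟨p, hp, hpa⟩
        obtain ⟨q, hq1, hq2⟩ := exists_rat_btwn hpa
        exact ⟨q, hq2, aux_up hFc hFmono hFrange hF₀mono (ω t) hp hq1.le⟩
      · rintro ⟨q, hq, hq2⟩
        exact ⟨q, hq2, hq⟩
    rw [this]
    refine MeasurableSet.iUnion fun q => MeasurableSet.iUnion fun _ => ?_
    unfold priceSet Rval
    simp only [mem_ofPred_eq]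
    have hb := aux_meas_int h1 continuous_id
    have he := aux_meas_int h3 continuous_id
    have hw := aux_meas_int h2 (f := fun x => F (q - x)) (by fun_prop)
    simp only [id] at hb he
    refine (MeasurableSet.const _).inter (measurableSet_le ?_ (hw.add_const _))
    exact (hD.sub (hb.sub he)).max measurable_const
  · have : priceT F F₀ Pbar D ηbar ω η ⁻¹' Iio a = univ := by
      ext t
      simp only [mem_preimage, mem_Iio, mem_univ, iff_true]
      exact (aux_le _ _ _ _ _ _).trans_lt (not_le.1 ha)
    rw [this]
    exact MeasurableSet.univ

theorem aux_price_aemeas {F F₀ : ℝ → ℝ} (hFc : Continuous F) (hFmono : Monotone F)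
    (hFrange : ∀ y, F y ∈ Icc (0:ℝ) 1) (hF₀mono : MonotoneOn F₀ (Ici 0)) (Pbar : ℝ)
    {T : ℝ} {S S' : Set ℝ} {D : ℝ → ℝ} (hD : BoundedVariationOn D (Icc 0 T))
    {ηbar ω η : ℝ → Measure ℝ}
    (h1 : IsMeasFlow T S ηbar) (h2 : IsMeasFlow T S' ω) (h3 : IsMeasFlow T S η) :
    AEMeasurable (priceT F F₀ Pbar D ηbar ω η) (volume.restrict (Icc 0 T)) := by
  obtain ⟨p, q, hp, hq, hpq⟩ :=
    hD.locallyBoundedVariationOn.exists_monotoneOn_sub_monotoneOn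
  have hDm : AEMeasurable D (volume.restrict (Icc 0 T)) := by
    rw [hpq]
    exact (aemeasurable_restrict_of_monotoneOn measurableSet_Icc hp).sub
      (aemeasurable_restrict_of_monotoneOn measurableSet_Icc hq)
  refine ⟨priceT F F₀ Pbar (hDm.mk D) ηbar ω η,
    aux_price_meas hFc hFmono hFrange hF₀mono Pbar hDm.measurable_mk h1 h2 h3, ?_⟩
  filter_upwards [hDm.ae_eq_mk] with t ht
  unfold priceT
  rw [ht]

theorem aux_G_deriv {F G : ℝ → ℝ} (hFc : Continuous F) (hG : ∀ x, G x = ∫ z in (0:ℝ)..x, F z)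
    (x : ℝ) : HasDerivAt G (F x) x := by
  have : G = fun x => ∫ z in (0:ℝ)..x, F z := funext hG
  rw [this]
  exact intervalIntegral.integral_hasDerivAt_right (hFc.intervalIntegrable _ _)
    (hFc.stronglyMeasurableAtFilter _ _) hFc.continuousAt

theorem aux_G_cont {F G : ℝ → ℝ} (hFc : Continuous F) (hG : ∀ x, G x = ∫ z in (0:ℝ)..x, F z) :
    Continuous G :=
  continuous_iff_continuousAt.2 fun x => (aux_G_deriv hFc hG x).continuousAt

theorem aux_G_bound {F G : ℝ → ℝ} (_hFc : Continuous F)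
    (hFrange : ∀ y, F y ∈ Icc (0:ℝ) 1) (hFneg : ∀ y ≤ (0:ℝ), F y = 0)
    (hG : ∀ x, G x = ∫ z in (0:ℝ)..x, F z) {p x : ℝ} (hx : 0 ≤ x) : |G (p - x)| ≤ |p| := by
  rcases le_total (p - x) 0 with h | h
  · have : G (p - x) = 0 := by
      rw [hG, intervalIntegral.integral_symm, neg_eq_zero]
      rw [intervalIntegral.integral_congr (g := fun _ => (0:ℝ))]
      · simp
      · intro y hy
        rw [uIcc_of_le h] at hy
        exact hFneg y hy.2
    rw [this, abs_zero]
    exact abs_nonneg _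
  · have h1 : ‖∫ z in (0:ℝ)..(p - x), F z‖ ≤ 1 * |p - x - 0| := by
      refine intervalIntegral.norm_integral_le_of_norm_le_const fun y _ => ?_
      rw [Real.norm_eq_abs, abs_of_nonneg (hFrange _).1]
      exact (hFrange _).2
    rw [← hG, Real.norm_eq_abs, one_mul, sub_zero] at h1
    refine h1.trans ?_
    rw [abs_of_nonneg h, abs_of_nonneg (by linarith)]
    linarith

theorem aux_ae_supp {T : ℝ} {S : Set ℝ} {m : ℝ → Measure ℝ} (hm : IsMeasFlow T S m) (t : ℝ) :
    ∀ᵐ x ∂(m t), x ∈ S := by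
  rw [ae_iff]
  exact hm.2.1 t

theorem aux_intG {F G : ℝ → ℝ} (hFc : Continuous F)
    (hFrange : ∀ y, F y ∈ Icc (0:ℝ) 1) (hFneg : ∀ y ≤ (0:ℝ), F y = 0)
    (hG : ∀ x, G x = ∫ z in (0:ℝ)..x, F z) {T : ℝ} {ω : ℝ → Measure ℝ}
    (hm : IsMeasFlow T (Ici 0) ω) (t p : ℝ) : Integrable (fun x => G (p - x)) (ω t) := by
  have := hm.1 t
  have hGc := aux_G_cont hFc hG
  refine Integrable.of_bound (by fun_prop) |p| ?_
  filter_upwards [aux_ae_supp hm t] with x hx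
  exact aux_G_bound hFc hFrange hFneg hG hx

theorem aux_H_deriv {F G : ℝ → ℝ} (hFc : Continuous F)
    (hFrange : ∀ y, F y ∈ Icc (0:ℝ) 1) (hFneg : ∀ y ≤ (0:ℝ), F y = 0)
    (hG : ∀ x, G x = ∫ z in (0:ℝ)..x, F z) {T : ℝ} {ω : ℝ → Measure ℝ}
    (hm : IsMeasFlow T (Ici 0) ω) (t p : ℝ) :
    HasDerivAt (fun p => ∫ x, G (p - x) ∂(ω t)) (∫ x, F (p - x) ∂(ω t)) p := by
  have := hm.1 t
  have hGc := aux_G_cont hFc hG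
  refine (hasDerivAt_integral_of_dominated_loc_of_deriv_le (s := univ) (bound := fun _ => 1)
    (F := fun p x => G (p - x)) (F' := fun p x => F (p - x)) univ_mem
    (Eventually.of_forall fun p => by fun_prop)
    (aux_intG hFc hFrange hFneg hG hm t p) (by fun_prop)
    (Eventually.of_forall fun x p _ => ?_) (integrable_const _)
    (Eventually.of_forall fun x p _ => ?_)).2
  · rw [Real.norm_eq_abs, abs_of_nonneg (hFrange _).1]
    exact (hFrange _).2
  · have h := (aux_G_deriv hFc hG (p - x)).comp p ((hasDerivAt_id p).sub_const x)
    rw [mul_one] at h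
    exact h

theorem aux_key {F F₀ G : ℝ → ℝ} (hFc : Continuous F) (hFmono : Monotone F)
    (hFrange : ∀ y, F y ∈ Icc (0:ℝ) 1) (hFneg : ∀ y ≤ (0:ℝ), F y = 0)
    (hG : ∀ x, G x = ∫ z in (0:ℝ)..x, F z)
    (hF₀zero : F₀ 0 = 0) (hF₀mono : MonotoneOn F₀ (Ici 0)) {Pbar : ℝ} (hPbar : 0 < Pbar)
    {T : ℝ} {ω₁ ω₂ : ℝ → Measure ℝ}
    (h1 : IsMeasFlow T (Ici 0) ω₁) (h2 : IsMeasFlow T (Ici 0) ω₂) (t D R₁ R₂ : ℝ) {P₁ P₂ : ℝ}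
    (e1 : P₁ = price F F₀ Pbar D R₁ (ω₁ t)) (e2 : P₂ = price F F₀ Pbar D R₂ (ω₂ t))
    (hlt : P₂ < P₁) :
    ((∫ x, G (P₁ - x) ∂(ω₁ t)) - ∫ x, G (P₁ - x) ∂(ω₂ t))
      - ((∫ x, G (P₂ - x) ∂(ω₁ t)) - ∫ x, G (P₂ - x) ∂(ω₂ t))
      + (P₁ - P₂) * (R₁ - R₂) < 0 := by
  have := h1.1 t
  have := h2.1 t
  have hd : ∀ p, HasDerivAt (fun p => (∫ x, G (p - x) ∂(ω₁ t)) - ∫ x, G (p - x) ∂(ω₂ t))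
      ((∫ x, F (p - x) ∂(ω₁ t)) - ∫ x, F (p - x) ∂(ω₂ t)) p := fun p =>
    (aux_H_deriv hFc hFrange hFneg hG h1 t p).sub (aux_H_deriv hFc hFrange hFneg hG h2 t p)
  obtain ⟨p, hp, he⟩ := exists_hasDerivAt_eq_slope _ _ hlt
    (fun p _ => (hd p).continuousAt.continuousWithinAt) (fun p _ => hd p)
  have hP2 : 0 ≤ P₂ := by rw [e2]; exact aux_nonneg F F₀ hPbar _ _ _
  have hP1 : P₁ ≤ Pbar := by rw [e1]; exact aux_le F F₀ Pbar _ _ _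
  have hp0 : 0 ≤ p := hP2.trans hp.1.le
  have hin : p ∈ priceSet F F₀ D R₂ (ω₂ t) := by
    have : price F F₀ Pbar D R₂ (ω₂ t) < p := by rw [← e2]; exact hp.1
    rw [aux_lt_iff F F₀ (hp.2.le.trans hP1)] at this
    obtain ⟨q, hq, hqp⟩ := this
    exact aux_up hFc hFmono hFrange hF₀mono _ hq hqp.le
  have hout : p ∉ priceSet F F₀ D R₁ (ω₁ t) := by
    intro h
    have : price F F₀ Pbar D R₁ (ω₁ t) < P₁ := (aux_lt_iff F F₀ hP1 _ _ _).2 ⟨p, h, hp.2⟩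
    rw [← e1] at this
    exact lt_irrefl _ this
  have hout' : (∫ x, F (p - x) ∂(ω₁ t)) + F₀ p < max (D - R₁) 0 := by
    by_contra hcon
    exact hout ⟨hp0, not_lt.1 hcon⟩
  have hin' := hin.2
  have hs : 0 ≤ ∫ x, F (p - x) ∂(ω₁ t) := integral_nonneg fun x => (hFrange _).1
  have hf : 0 ≤ F₀ p := by
    have := hF₀mono (mem_Ici.2 le_rfl) (mem_Ici.2 hp0) hp0
    rwa [hF₀zero] at this
  have hDR : (∫ x, F (p - x) ∂(ω₁ t)) + F₀ p < D - R₁ := by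
    rcases lt_max_iff.1 hout' with h | h
    · exact h
    · linarith
  have hDR2 : D - R₂ ≤ (∫ x, F (p - x) ∂(ω₂ t)) + F₀ p := (le_max_left _ _).trans hin'
  have hpos : 0 < P₁ - P₂ := sub_pos.2 hlt
  rw [eq_div_iff hpos.ne'] at he
  rw [← he]
  nlinarith

theorem aux_intC {F G : ℝ → ℝ} (hFc : Continuous F)
    (hFrange : ∀ y, F y ∈ Icc (0:ℝ) 1) (hFneg : ∀ y ≤ (0:ℝ), F y = 0)
    (hG : ∀ x, G x = ∫ z in (0:ℝ)..x, F z) {T ρ Pbar : ℝ} {ω : ℝ → Measure ℝ}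
    (hm : IsMeasFlow T (Ici 0) ω) {P f : ℝ → ℝ} (hf : Continuous f)
    (hP : AEMeasurable P (volume.restrict (Icc 0 T))) (hP0 : ∀ t, 0 ≤ P t)
    (hPb : ∀ t, P t ≤ Pbar) :
    IntegrableOn (fun t => Real.exp (-ρ * t) * ∫ x, (G (P t - x) + f t) ∂(ω t)) (Icc 0 T) := by
  have hGc := aux_G_cont hFc hG
  have hc : Continuous fun t => Real.exp (-ρ * t) := by fun_prop
  obtain ⟨C, hC⟩ := isCompact_Icc.exists_bound_of_continuousOn (s := Icc (0:ℝ) T) hf.continuousOn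
  obtain ⟨E, hE⟩ := isCompact_Icc.exists_bound_of_continuousOn (s := Icc (0:ℝ) T) hc.continuousOn
  have hj : Measurable (Function.uncurry fun p t => ∫ x, G (p - x) ∂(ω t)) :=
    measurable_uncurry_of_continuous_of_measurable
      (fun t => continuous_iff_continuousAt.2 fun p =>
        (aux_H_deriv hFc hFrange hFneg hG hm t p).continuousAt)
      (fun p => aux_meas_int hm (f := fun x => G (p - x)) (by fun_prop))
  have hj' : AEMeasurable (fun t => ∫ x, G (P t - x) ∂(ω t)) (volume.restrict (Icc 0 T)) :=
    hj.comp_aemeasurable (hP.prodMk aemeasurable_id)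
  have heq : ∀ t, (∫ x, (G (P t - x) + f t) ∂(ω t))
      = (∫ x, G (P t - x) ∂(ω t)) + (ω t univ).toReal * f t := by
    intro t
    have := hm.1 t
    rw [integral_add (aux_intG hFc hFrange hFneg hG hm t _) (integrable_const _)]
    simp [Measure.real]
  have hmass : Measurable fun t => (ω t univ).toReal := (hm.2.2.1 _ MeasurableSet.univ).ennreal_toReal
  refine Integrable.mono' (hm.2.2.2.const_mul (E * (Pbar + C))) ?_ ?_
  · refine AEMeasurable.aestronglyMeasurable ?_
    simp only [heq]
    exact hc.measurable.aemeasurable.mul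
      (hj'.add (hmass.mul hf.measurable).aemeasurable)
  · filter_upwards [ae_restrict_mem measurableSet_Icc] with t ht
    have := hm.1 t
    have hb : ‖∫ x, (G (P t - x) + f t) ∂(ω t)‖ ≤ (Pbar + C) * (ω t).real univ := by
      refine norm_integral_le_of_norm_le_const ?_
      filter_upwards [aux_ae_supp hm t] with x hx
      refine (norm_add_le _ _).trans (add_le_add ?_ (hC t ht))
      refine (aux_G_bound hFc hFrange hFneg hG hx).trans ?_
      rw [abs_of_nonneg (hP0 t)]
      exact hPb t
    rw [norm_mul, mul_assoc]
    exact mul_le_mul (hE t ht) hb (norm_nonneg _) ((norm_nonneg _).trans (hE t ht))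

theorem aux_intx {T : ℝ} {η : ℝ → Measure ℝ}
    (hm : IsMeasFlow T (Icc 0 1) η) (t : ℝ) : Integrable (fun x => x) (η t) := by
  have := hm.1 t
  refine Integrable.of_bound (by fun_prop) 1 ?_
  filter_upwards [aux_ae_supp hm t] with x hx
  rw [Real.norm_eq_abs, abs_of_nonneg hx.1]
  exact hx.2

theorem aux_eqR {T : ℝ} {η : ℝ → Measure ℝ}
    (hm : IsMeasFlow T (Icc 0 1) η) (t P f : ℝ) :
    (∫ x, (-P * x + f) ∂(η t)) = -P * (∫ x, x ∂(η t)) + (η t univ).toReal * f := by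
  have := hm.1 t
  rw [integral_add ((aux_intx hm t).const_mul _) (integrable_const _), integral_const_mul]
  simp [Measure.real]

theorem aux_intR {T ρ Pbar : ℝ} {η : ℝ → Measure ℝ}
    (hm : IsMeasFlow T (Icc 0 1) η) {P f : ℝ → ℝ} (hf : Continuous f)
    (hP : AEMeasurable P (volume.restrict (Icc 0 T))) (hP0 : ∀ t, 0 ≤ P t)
    (hPb : ∀ t, P t ≤ Pbar) :
    IntegrableOn (fun t => Real.exp (-ρ * t) * ∫ x, (-(P t) * x + f t) ∂(η t)) (Icc 0 T) := by
  have hc : Continuous fun t => Real.exp (-ρ * t) := by fun_prop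
  obtain ⟨C, hC⟩ := isCompact_Icc.exists_bound_of_continuousOn (s := Icc (0:ℝ) T) hf.continuousOn
  obtain ⟨E, hE⟩ := isCompact_Icc.exists_bound_of_continuousOn (s := Icc (0:ℝ) T) hc.continuousOn
  have hx := aux_meas_int hm continuous_id
  simp only [id] at hx
  have hmass : Measurable fun t => (η t univ).toReal := (hm.2.2.1 _ MeasurableSet.univ).ennreal_toReal
  refine Integrable.mono' (hm.2.2.2.const_mul (E * (Pbar + C))) ?_ ?_
  · refine AEMeasurable.aestronglyMeasurable ?_
    simp only [aux_eqR hm]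
    exact hc.measurable.aemeasurable.mul
      ((hP.neg.mul hx.aemeasurable).add (hmass.mul hf.measurable).aemeasurable)
  · filter_upwards [ae_restrict_mem measurableSet_Icc] with t ht
    have := hm.1 t
    have hb : ‖∫ x, (-(P t) * x + f t) ∂(η t)‖ ≤ (Pbar + C) * (η t).real univ := by
      refine norm_integral_le_of_norm_le_const ?_
      filter_upwards [aux_ae_supp hm t] with x hx
      refine (norm_add_le _ _).trans (add_le_add ?_ (hC t ht))
      rw [norm_mul, norm_neg, Real.norm_eq_abs, Real.norm_eq_abs, abs_of_nonneg (hP0 t),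
        abs_of_nonneg hx.1]
      nlinarith [hP0 t, hPb t, hx.1, hx.2]
    rw [norm_mul, mul_assoc]
    exact mul_le_mul (hE t ht) hb (norm_nonneg _) ((norm_nonneg _).trans (hE t ht))

end Helpers

/-- uniqueness of the equilibrium price process: any two Nash equilibria of
the relaxed mean-field game give rise to price trajectories that coincide for
Lebesgue-almost every `t ∈ [0,T]`. -/
theorem nash_price_uniqueness
    (T k θ δ : ℝ) (hT : 0 < T) (hk : 0 < k) (hθ : 0 < θ) (hδ : 0 < δ)
    (kb θb δb : ℝ) (hkb : 0 < kb) (hθb : θb ∈ Ioo (0:ℝ) 1) (hδb : 0 < δb)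
    (F : ℝ → ℝ) (c₁ : ℝ) (hc₁ : 0 < c₁) (hFsm : ContDiff ℝ (⊤ : ℕ∞) F) (hFmono : Monotone F)
    (hFrange : ∀ y, F y ∈ Icc (0:ℝ) 1) (hFneg : ∀ y ≤ (0:ℝ), F y = 0)
    (hFpos : ∀ y > (0:ℝ), 0 < F y) (hFone : ∀ y ≥ c₁, F y = 1)
    (F₀ : ℝ → ℝ) (c : ℝ) (hc : 0 < c) (hF₀zero : F₀ 0 = 0)
    (hF₀mono : MonotoneOn F₀ (Ici 0))
    (hF₀slope : ∀ p h : ℝ, 0 ≤ p → 0 ≤ h → c * h ≤ F₀ (p + h) - F₀ p)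
    (Pbar : ℝ) (hPbar : 0 < Pbar)
    (ηbar₀ : Measure ℝ) (hηbar₀fin : IsFiniteMeasure ηbar₀)
    (hηbar₀supp : ηbar₀ (Icc (0:ℝ) 1)ᶜ = 0)
    (ηbar : ℝ → Measure ℝ) (hηbar : AdmR T kb θb δb ηbar₀ ηbar)
    (D : ℝ → ℝ) (hD : BoundedVariationOn D (Icc 0 T))
    (ω₀ : Measure ℝ) (hω₀fin : IsFiniteMeasure ω₀) (hω₀supp : ω₀ (Ici (0:ℝ))ᶜ = 0)
    (η₀ : Measure ℝ) (hη₀fin : IsFiniteMeasure η₀) (hη₀supp : η₀ (Icc (0:ℝ) 1)ᶜ = 0)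
    (ρ κC KC γC : ℝ) (hρ : 0 < ρ) (hκC : 0 ≤ κC) (hKC : 0 ≤ KC) (hγC : 0 ≤ γC)
    (G fC : ℝ → ℝ) (hG : ∀ x, G x = ∫ z in (0:ℝ)..x, F z)
    (hfC : ∀ t, fC t = -κC - Real.exp (-γC * t) * KC * (ρ + γC))
    (κR KR γR : ℝ) (hκR : 0 ≤ κR) (hKR : 0 ≤ KR) (hγR : 0 ≤ γR)
    (fR : ℝ → ℝ)
    (hfR : ∀ t, fR t = κR + ρ * KR + γR * KR * Real.exp (-(ρ + γR) * (T - t)))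
    (ω₁ η₁ ω₂ η₂ : ℝ → Measure ℝ)
    (hN₁ : NashEq T k θ δ kb θb δb ρ F F₀ G fC fR Pbar D ω₀ η₀ ηbar ω₁ η₁)
    (hN₂ : NashEq T k θ δ kb θb δb ρ F F₀ G fC fR Pbar D ω₀ η₀ ηbar ω₂ η₂) :
    volume {t ∈ Icc (0:ℝ) T |
      priceT F F₀ Pbar D ηbar ω₁ η₁ t ≠ priceT F F₀ Pbar D ηbar ω₂ η₂ t} = 0 := by
  have hFc : Continuous F := hFsm.continuous
  have hfCc : Continuous fC := by
    rw [funext hfC]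
    fun_prop
  have hfRc : Continuous fR := by
    rw [funext hfR]
    fun_prop
  obtain ⟨aC1, aR1, nC1, nR1⟩ := hN₁
  obtain ⟨aC2, aR2, nC2, nR2⟩ := hN₂
  have iC1 := nC1 ω₂ aC2
  have iC2 := nC2 ω₁ aC1
  have iR1 := nR1 η₂ aR2
  have iR2 := nR2 η₁ aR1
  have mP1 := aux_price_aemeas hFc hFmono hFrange hF₀mono Pbar hD hηbar.1 aC1.1 aR1.1
  have mP2 := aux_price_aemeas hFc hFmono hFrange hF₀mono Pbar hD hηbar.1 aC2.1 aR2.1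
  have dP1 : ∀ t, priceT F F₀ Pbar D ηbar ω₁ η₁ t
      = price F F₀ Pbar (D t) (Rval (ηbar t) (η₁ t)) (ω₁ t) := fun t => rfl
  have dP2 : ∀ t, priceT F F₀ Pbar D ηbar ω₂ η₂ t
      = price F F₀ Pbar (D t) (Rval (ηbar t) (η₂ t)) (ω₂ t) := fun t => rfl
  have zP1 : ∀ t, 0 ≤ priceT F F₀ Pbar D ηbar ω₁ η₁ t := fun t => aux_nonneg F F₀ hPbar _ _ _
  have zP2 : ∀ t, 0 ≤ priceT F F₀ Pbar D ηbar ω₂ η₂ t := fun t => aux_nonneg F F₀ hPbar _ _ _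
  have bP1 : ∀ t, priceT F F₀ Pbar D ηbar ω₁ η₁ t ≤ Pbar := fun t => aux_le F F₀ Pbar _ _ _
  have bP2 : ∀ t, priceT F F₀ Pbar D ηbar ω₂ η₂ t ≤ Pbar := fun t => aux_le F F₀ Pbar _ _ _
  generalize priceT F F₀ Pbar D ηbar ω₁ η₁ = P₁ at *
  generalize priceT F F₀ Pbar D ηbar ω₂ η₂ = P₂ at *
  have C11 := aux_intC (ρ := ρ) hFc hFrange hFneg hG aC1.1 hfCc mP1 zP1 bP1
  have C12 := aux_intC (ρ := ρ) hFc hFrange hFneg hG aC2.1 hfCc mP1 zP1 bP1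
  have C21 := aux_intC (ρ := ρ) hFc hFrange hFneg hG aC1.1 hfCc mP2 zP2 bP2
  have C22 := aux_intC (ρ := ρ) hFc hFrange hFneg hG aC2.1 hfCc mP2 zP2 bP2
  have R11 := aux_intR (ρ := ρ) aR1.1 hfRc mP1 zP1 bP1
  have R12 := aux_intR (ρ := ρ) aR2.1 hfRc mP1 zP1 bP1
  have R21 := aux_intR (ρ := ρ) aR1.1 hfRc mP2 zP2 bP2
  have R22 := aux_intR (ρ := ρ) aR2.1 hfRc mP2 zP2 bP2
  have sC1 := integral_sub C12 C11
  have sC2 := integral_sub C21 C22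
  have sR1 := integral_sub R12 R11
  have sR2 := integral_sub R21 R22
  have sC := integral_add (C12.sub C11) (C21.sub C22)
  have sR := integral_add (R12.sub R11) (R21.sub R22)
  have iAll := ((C12.sub C11).add (C21.sub C22)).add ((R12.sub R11).add (R21.sub R22))
  have sAll := integral_add ((C12.sub C11).add (C21.sub C22)) ((R12.sub R11).add (R21.sub R22))
  simp only [Pi.add_apply, Pi.sub_apply] at sC1 sC2 sR1 sR2 sC sR sAll
  rw [sC, sR, sC1, sC2, sR1, sR2] at sAll
  have hle := sAll.trans_le (c := 0) (by linarith)
  have hval : ∀ t, (Real.exp (-ρ * t) * (∫ x, (G (P₁ t - x) + fC t) ∂(ω₂ t))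
        - Real.exp (-ρ * t) * (∫ x, (G (P₁ t - x) + fC t) ∂(ω₁ t))
      + (Real.exp (-ρ * t) * (∫ x, (G (P₂ t - x) + fC t) ∂(ω₁ t))
        - Real.exp (-ρ * t) * (∫ x, (G (P₂ t - x) + fC t) ∂(ω₂ t))))
      + (Real.exp (-ρ * t) * (∫ x, (-(P₁ t) * x + fR t) ∂(η₂ t))
        - Real.exp (-ρ * t) * (∫ x, (-(P₁ t) * x + fR t) ∂(η₁ t))
      + (Real.exp (-ρ * t) * (∫ x, (-(P₂ t) * x + fR t) ∂(η₁ t))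
        - Real.exp (-ρ * t) * (∫ x, (-(P₂ t) * x + fR t) ∂(η₂ t))))
      = Real.exp (-ρ * t) * -(((∫ x, G (P₁ t - x) ∂(ω₁ t)) - ∫ x, G (P₁ t - x) ∂(ω₂ t))
      - ((∫ x, G (P₂ t - x) ∂(ω₁ t)) - ∫ x, G (P₂ t - x) ∂(ω₂ t))
      + (P₁ t - P₂ t) * (Rval (ηbar t) (η₁ t) - Rval (ηbar t) (η₂ t))) := by
    intro t
    have := aC1.1.1 t
    have := aC2.1.1 t
    rw [integral_add (aux_intG hFc hFrange hFneg hG aC1.1 t _) (integrable_const _),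
      integral_add (aux_intG hFc hFrange hFneg hG aC2.1 t _) (integrable_const _),
      integral_add (aux_intG hFc hFrange hFneg hG aC1.1 t _) (integrable_const _),
      integral_add (aux_intG hFc hFrange hFneg hG aC2.1 t _) (integrable_const _),
      aux_eqR aR1.1, aux_eqR aR2.1, aux_eqR aR1.1, aux_eqR aR2.1]
    unfold Rval
    ring
  have hpos : ∀ t, P₁ t ≠ P₂ t →
      0 < Real.exp (-ρ * t) * -(((∫ x, G (P₁ t - x) ∂(ω₁ t)) - ∫ x, G (P₁ t - x) ∂(ω₂ t))
      - ((∫ x, G (P₂ t - x) ∂(ω₁ t)) - ∫ x, G (P₂ t - x) ∂(ω₂ t))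
      + (P₁ t - P₂ t) * (Rval (ηbar t) (η₁ t) - Rval (ηbar t) (η₂ t))) := by
    intro t hne
    refine mul_pos (Real.exp_pos _) ?_
    rcases lt_or_gt_of_ne hne with h | h
    · have := aux_key hFc hFmono hFrange hFneg hG hF₀zero hF₀mono hPbar aC2.1 aC1.1 t (D t)
        _ _ (dP2 t) (dP1 t) h
      linarith
    · have := aux_key hFc hFmono hFrange hFneg hG hF₀zero hF₀mono hPbar aC1.1 aC2.1 t (D t)
        _ _ (dP1 t) (dP2 t) h
      linarith
  have iAll' := iAll.congr (Eventually.of_forall hval)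
  simp only [hval] at hle
  have hnn : ∀ t, 0 ≤ Real.exp (-ρ * t) *
      -(((∫ x, G (P₁ t - x) ∂(ω₁ t)) - ∫ x, G (P₁ t - x) ∂(ω₂ t))
      - ((∫ x, G (P₂ t - x) ∂(ω₁ t)) - ∫ x, G (P₂ t - x) ∂(ω₂ t))
      + (P₁ t - P₂ t) * (Rval (ηbar t) (η₁ t) - Rval (ηbar t) (η₂ t))) := by
    intro t
    by_cases h : P₁ t = P₂ t
    · rw [h]
      simp
    · exact (hpos t h).le
  have h0 := (integral_eq_zero_iff_of_nonneg_ae (Eventually.of_forall hnn) iAll').1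
    (le_antisymm hle (integral_nonneg hnn))
  have h1 := (ae_restrict_iff' measurableSet_Icc).1 h0
  rw [ae_iff] at h1
  refine measure_mono_null ?_ h1
  rintro t ⟨ht, hne⟩ hcon
  exact (hpos t hne).ne' (hcon ht)

end
end

section
/- For every flow ω ∈ A(ω₀), one has ω_t(Ω) ≤ ω₀(Ω) for Lebesgue-almost every t ∈ [0,T]. -/
open MeasureTheory Set Filter
open scoped Classical

noncomputable section

/-- for every admissible flow `ω ∈ A(ω₀)`, the total mass is dominated by
the initial mass for Lebesgue-almost every time in `[0,T]`. -/
theorem admissible_mass_nonincreasing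
    (T k θ δ : ℝ) (hT : 0 < T) (hk : 0 < k) (hθ : 0 < θ) (hδ : 0 < δ)
    (ω₀ : Measure ℝ) (hω₀fin : IsFiniteMeasure ω₀) (hω₀supp : ω₀ (Ici (0:ℝ))ᶜ = 0)
    (ω : ℝ → Measure ℝ) (hω : AdmC T k θ δ ω₀ ω) :
    ∀ᵐ t ∂(volume.restrict (Icc (0:ℝ) T)), ω t Set.univ ≤ ω₀ Set.univ := by
  obtain ⟨⟨hfin, -, hmeas, hint⟩, hFP⟩ := hω
  set f : ℝ → ℝ := fun t => (ω t Set.univ).toReal with hf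
  set c : ℝ := (ω₀ Set.univ).toReal with hc
  have hfm : Measurable f := (hmeas _ MeasurableSet.univ).ennreal_toReal
  have key : ∀ φ : ℝ → ℝ, Continuous φ → (∀ t, 0 ≤ φ t) → (∀ t, φ t ≤ 1) →
      0 ≤ ∫ t in Icc (0:ℝ) T, φ t * (c - f t) := by
    intro φ hφ h0 h1
    have hd : ∀ t, HasDerivAt (fun s => ∫ r in s..T, φ r) (-φ t) t := fun t =>
      intervalIntegral.integral_hasDerivAt_left (hφ.intervalIntegrable _ _)
        (hφ.stronglyMeasurableAtFilter _ _) hφ.continuousAt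
    have hdc : Continuous (fun s => ∫ r in s..T, φ r) :=
      continuous_iff_continuousAt.2 fun t => (hd t).continuousAt
    have h := hFP (fun t _ => ∫ r in t..T, φ r) (fun t _ => -φ t) (fun _ _ => 0) (fun _ _ => 0)
      (hdc.comp continuous_fst).continuousOn (hφ.neg.comp continuous_fst).continuousOn
      continuousOn_const continuousOn_const (fun t _ x _ => hd t)
      (fun t _ x _ => hasDerivAt_const _ _) (fun t _ x _ => hasDerivAt_const _ _)
      (fun t ht x _ => intervalIntegral.integral_nonneg ht.2 fun r _ => h0 r)
      ⟨1, fun t _ x _ => by simp [gen, abs_of_nonneg (h0 t), h1 t]⟩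
    have e : ∫ t in Icc (0:ℝ) T, φ t * (c - f t) =
        (∫ t in Icc (0:ℝ) T, φ t) * c + ∫ t in Icc (0:ℝ) T, f t * (-φ t) := by
      rw [← integral_mul_const, ← integral_add]
      · congr 1; ext t; ring
      · exact (hφ.integrableOn_Icc).mul_const c
      · refine Integrable.mul_bdd (c := 1) hint hφ.neg.aestronglyMeasurable ?_
        exact ae_of_all _ fun t => by simp [abs_of_nonneg (h0 t), h1 t]
    rw [e]
    simp only [gen, mul_zero, add_zero, integral_const, smul_eq_mul, Measure.real] at h
    rw [intervalIntegral.integral_of_le hT.le, ← integral_Icc_eq_integral_Ioc, mul_comm] at h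
    exact h
  have hgi : IntegrableOn (fun t => c - f t) (Icc 0 T) :=
    (integrable_const c).sub hint
  have hreal : ∀ᵐ t ∂(volume.restrict (Icc (0:ℝ) T)), f t ≤ c := by
    rw [ae_iff]
    by_contra hne
    have hBm : MeasurableSet {t | ¬ f t ≤ c} := (measurableSet_le hfm measurable_const).compl
    rw [Measure.restrict_apply hBm] at hne
    obtain ⟨K, hKB, hKc, hK⟩ :=
      (hBm.inter measurableSet_Icc).exists_lt_isCompact (pos_iff_ne_zero.2 hne)
    have hKm := hKc.measurableSet
    have hKI : K ⊆ Icc 0 T := fun t ht => (hKB ht).2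
    let δs : ℕ → ℝ := fun n => 1 / ((n:ℝ) + 1)
    have hδs : ∀ n, 0 < δs n := fun n => Nat.one_div_pos_of_nat
    have hlim : Tendsto (fun n => ∫ t in Icc (0:ℝ) T,
        (thickenedIndicator (hδs n) K t : ℝ) * (c - f t)) atTop
        (nhds (∫ t in Icc (0:ℝ) T, K.indicator (fun _ => (1:ℝ)) t * (c - f t))) := by
      refine tendsto_integral_of_dominated_convergence (fun t => ‖c - f t‖) ?_ hgi.norm ?_ ?_
      · intro n
        refine AEStronglyMeasurable.mul ?_ hgi.aestronglyMeasurable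
        exact (NNReal.continuous_coe.comp
          (thickenedIndicator (hδs n) K).continuous).aestronglyMeasurable
      · intro n
        refine ae_of_all _ fun t => ?_
        rw [norm_mul]
        refine mul_le_of_le_one_left (norm_nonneg _) ?_
        rw [Real.norm_of_nonneg (NNReal.coe_nonneg _)]
        exact_mod_cast thickenedIndicator_le_one (hδs n) K t
      · refine ae_of_all _ fun t => Tendsto.mul_const _ ?_
        have h := thickenedIndicator_tendsto_indicator_closure hδs
          tendsto_one_div_add_atTop_nhds_zero_nat K
        rw [hKc.isClosed.closure_eq, tendsto_pi_nhds] at h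
        have h2 := (NNReal.continuous_coe.tendsto _).comp (h t)
        have e2 : K.indicator (fun _ => (1:ℝ)) t =
            ((K.indicator (fun _ => (1:NNReal)) t : NNReal) : ℝ) := by
          by_cases ht : t ∈ K <;> simp [ht]
        rw [e2]
        exact h2
    have hnn : 0 ≤ ∫ t in Icc (0:ℝ) T, K.indicator (fun _ => (1:ℝ)) t * (c - f t) := by
      refine ge_of_tendsto' hlim fun n => key _ ?_ (fun t => NNReal.coe_nonneg _) fun t => ?_
      · exact NNReal.continuous_coe.comp (thickenedIndicator (hδs n) K).continuous
      · exact_mod_cast thickenedIndicator_le_one (hδs n) K t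
    have e : ∫ t in Icc (0:ℝ) T, K.indicator (fun _ => (1:ℝ)) t * (c - f t) =
        ∫ t in K, (c - f t) := by
      have : (fun t => K.indicator (fun _ => (1:ℝ)) t * (c - f t)) =
          K.indicator (fun t => c - f t) := by
        ext t; by_cases ht : t ∈ K <;> simp [ht]
      rw [this, setIntegral_indicator hKm, inter_eq_right.2 hKI]
    rw [e] at hnn
    have hpos : 0 < ∫ t in K, (f t - c) := by
      rw [setIntegral_pos_iff_support_of_nonneg_ae]
      · rwa [inter_eq_right.2]
        intro t ht
        have := (hKB ht).1
        simp only [mem_ofPred_eq, not_le] at this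
        exact (sub_pos.2 this).ne'
      · filter_upwards [ae_restrict_mem hKm] with t ht
        have := (hKB ht).1
        simp only [mem_ofPred_eq, not_le] at this
        exact (sub_pos.2 this).le
      · have := (hgi.mono_set hKI).neg
        refine this.congr (ae_of_all _ fun t => ?_)
        simp
    have : ∫ t in K, (f t - c) = - ∫ t in K, (c - f t) := by
      rw [← integral_neg]; simp
    linarith
  filter_upwards [hreal] with t ht
  have := hfin t
  exact (ENNReal.toReal_le_toReal (measure_ne_top _ _) (measure_ne_top _ _)).1 ht

end
end

section
/- Let n ≥ 0 be an integer, let C > 0, and let f₀, …, fₙ : ℝ → ℝ be bounded measurable functions vanishing outside [0,T], such that for all bounded continuously differentiable functions ψ₀, …, ψₙ : ℝ → ℝ with bounded derivatives one has Σ_{k=0}^{n} ∫_ℝ f_k(t) ψ'_k(t) dt ≤ C sup_{t∈ℝ} Σ_{k=0}^{n} |ψ_k(t)|. Then for every m ≥ 1, the mollified functions f_k^m = ρ_m * f_k are smooth and satisfy ∫_ℝ max_{0≤k≤n} | (d/dt) f_k^m(t) | dt ≤ C. -/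
open MeasureTheory Set Filter
open scoped Classical

noncomputable section

theorem aux_locInt (f : ℝ → ℝ) (hf : Measurable f) (M : ℝ) (hb : ∀ t, |f t| ≤ M) :
    LocallyIntegrable f volume := by
  have h1 : LocallyIntegrable (fun _ : ℝ => M) volume := locallyIntegrable_const M
  refine h1.mono hf.aestronglyMeasurable (ae_of_all _ fun t => ?_)
  rw [Real.norm_eq_abs, Real.norm_eq_abs]
  exact (hb t).trans (le_abs_self M)

theorem aux_smooth (r f : ℝ → ℝ) (hr : ContDiff ℝ (⊤ : ℕ∞) r) (hc : HasCompactSupport r)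
    (hf : Measurable f) (M : ℝ) (hb : ∀ t, |f t| ≤ M) :
    ContDiff ℝ (⊤ : ℕ∞) (fun t => ∫ s, r s * f (t - s)) :=
  HasCompactSupport.contDiff_convolution_left (ContinuousLinearMap.mul ℝ ℝ) hc hr
    (aux_locInt f hf M hb)

theorem aux_deriv (r f : ℝ → ℝ) (hr : ContDiff ℝ (⊤ : ℕ∞) r) (hc : HasCompactSupport r)
    (hf : Measurable f) (M : ℝ) (hb : ∀ t, |f t| ≤ M) (t : ℝ) :
    deriv (fun t => ∫ s, r s * f (t - s)) t = ∫ s, deriv r s * f (t - s) :=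
  (HasCompactSupport.hasDerivAt_convolution_left (ContinuousLinearMap.mul ℝ ℝ) hc
    (hr.of_le (by exact_mod_cast le_top)) (aux_locInt f hf M hb) t).deriv

theorem aux_select (n : ℕ) (h : Fin (n + 1) → ℝ → ℝ) (hm : ∀ j, Measurable (h j)) :
    ∃ φ : Fin (n + 1) → ℝ → ℝ, (∀ j, Measurable (φ j)) ∧ (∀ j t, |φ j t| ≤ 1) ∧
      (∀ t, ∑ j, |φ j t| ≤ 1) ∧ ∀ t, ∑ j, φ j t * h j t = ⨆ j, |h j t| := by
  let Q : Fin (n + 1) → Set ℝ := fun j => {t | ∀ i, |h i t| ≤ |h j t|}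
  have hQ : ∀ j, MeasurableSet (Q j) := fun j => by
    have : Q j = ⋂ i, {t | |h i t| ≤ |h j t|} := by ext t; simp [Q]
    rw [this]
    exact MeasurableSet.iInter fun i => measurableSet_le (hm i).abs (hm j).abs
  let P : Fin (n + 1) → Set ℝ := fun j => Q j ∩ ⋂ i, ⋂ (_ : i < j), (Q i)ᶜ
  have hP : ∀ j, MeasurableSet (P j) := fun j =>
    (hQ j).inter (MeasurableSet.iInter fun i => MeasurableSet.iInter fun _ => (hQ i).compl)
  let φ : Fin (n + 1) → ℝ → ℝ := fun j => (P j).indicator (fun t => if 0 ≤ h j t then 1 else -1)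
  have key : ∀ t, ∃ j, t ∈ P j ∧ ∀ i, i ≠ j → t ∉ P i := by
    intro t
    have hne : {j | t ∈ Q j}.Nonempty := by
      obtain ⟨j, hj⟩ := Finite.exists_max (fun j => |h j t|)
      exact ⟨j, hj⟩
    obtain ⟨j, hj, hmin⟩ := WellFounded.has_min (wellFounded_lt (α := Fin (n+1))) _ hne
    have hjP : t ∈ P j := by
      refine ⟨hj, ?_⟩
      simp only [mem_iInter]
      exact fun i hi hq => hmin i hq hi
    refine ⟨j, hjP, fun i hi hiP => ?_⟩
    rcases lt_or_gt_of_ne hi with hlt | hlt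
    · exact hmin i hiP.1 hlt
    · have := hiP.2
      simp only [mem_iInter] at this
      exact this j hlt hj
  have hφ1 : ∀ j t, |φ j t| ≤ 1 := by
    intro j t
    simp only [φ, indicator]
    split_ifs <;> simp
  refine ⟨φ, fun j => ?_, hφ1, fun t => ?_, fun t => ?_⟩
  · refine Measurable.indicator ?_ (hP j)
    exact Measurable.ite (measurableSet_le measurable_const (hm j)) measurable_const measurable_const
  · obtain ⟨j, hj, hj'⟩ := key t
    rw [Finset.sum_eq_single j]
    · exact hφ1 j t
    · intro i _ hi
      simp [φ, hj' i hi]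
    · simp
  · obtain ⟨j, hj, hj'⟩ := key t
    rw [Finset.sum_eq_single j]
    · have : φ j t * h j t = |h j t| := by
        simp only [φ, indicator_of_mem hj]
        split_ifs with h0
        · rw [one_mul, abs_of_nonneg h0]
        · rw [abs_of_neg (not_le.mp h0)]; ring
      rw [this]
      refine le_antisymm (le_ciSup (f := fun j => |h j t|) (Set.finite_range _).bddAbove j)
        (ciSup_le fun i => hj.1 i)
    · intro i _ hi
      simp [φ, hj' i hi]
    · simp

/-- Fubini. -/
theorem aux_fubini (q f φ : ℝ → ℝ) (hq : Integrable q) (hf : Integrable f)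
    (hφ : Measurable φ) (hφ1 : ∀ t, |φ t| ≤ 1) :
    ∫ t, φ t * ∫ s, q s * f (t - s) = ∫ u, f u * ∫ s, q (-s) * φ (u - s) := by
  have e1 : ∀ t, ∫ s, q s * f (t - s) = ∫ u, f u * q (t - u) := by
    intro t
    rw [← integral_sub_left_eq_self _ volume t]
    simp [mul_comm]
  have e2 : ∀ u, ∫ s, q (-s) * φ (u - s) = ∫ t, φ t * q (t - u) := by
    intro u
    rw [← integral_sub_left_eq_self _ volume u]
    simp [mul_comm]
  simp_rw [e1, e2, ← integral_const_mul]
  rw [integral_integral_swap]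
  · congr 1; ext u; congr 1; ext t; ring
  · have h0 := Integrable.convolution_integrand (ContinuousLinearMap.mul ℝ ℝ) hf hq
    refine Integrable.bdd_mul (c := 1) h0 ?_ ?_
    · exact (hφ.comp measurable_fst).aestronglyMeasurable
    · exact ae_of_all _ fun p => hφ1 p.1

theorem aux_main (r : ℝ → ℝ) (hr : ContDiff ℝ (⊤ : ℕ∞) r) (hc : HasCompactSupport r)
    (hpos : ∀ x, 0 ≤ r x) (hint : ∫ x, r x = 1)
    (n : ℕ) (C : ℝ)
    (f : Fin (n + 1) → ℝ → ℝ)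
    (hfmeas : ∀ j, Measurable (f j))
    (hfbdd : ∀ j, ∃ M, ∀ t, |f j t| ≤ M)
    (hfint : ∀ j, Integrable (f j))
    (hdual : ∀ ψ : Fin (n + 1) → ℝ → ℝ, (∀ j, ContDiff ℝ 1 (ψ j)) →
      (∀ j, ∃ M, ∀ t, |ψ j t| ≤ M) → (∀ j, ∃ M, ∀ t, |deriv (ψ j) t| ≤ M) →
      ∀ Mψ : ℝ, (∀ t, (∑ j : Fin (n + 1), |ψ j t|) ≤ Mψ) →
      (∑ j : Fin (n + 1), ∫ t, f j t * deriv (ψ j) t) ≤ C * Mψ) :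
    (∫⁻ t, ENNReal.ofReal (⨆ j : Fin (n + 1),
        |deriv (fun t => ∫ s, r s * f j (t - s)) t|)) ≤ ENNReal.ofReal C := by
  have hrint : Integrable r := hr.continuous.integrable_of_hasCompactSupport hc
  have hdint : Integrable (deriv r) :=
    (hr.continuous_deriv (by exact_mod_cast le_top)).integrable_of_hasCompactSupport hc.deriv
  let h : Fin (n + 1) → ℝ → ℝ := fun j t => ∫ s, deriv r s * f j (t - s)
  have hh : ∀ j t, deriv (fun t => ∫ s, r s * f j (t - s)) t = h j t := fun j t => by
    obtain ⟨M, hM⟩ := hfbdd j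
    exact aux_deriv r (f j) hr hc (hfmeas j) M hM t
  have hmeas : ∀ j, Measurable (h j) := fun j => by
    have : h j = deriv (fun t => ∫ s, r s * f j (t - s)) := by ext t; exact (hh j t).symm
    rw [this]; exact measurable_deriv _
  have hhint : ∀ j, Integrable (h j) := fun j =>
    hdint.integrable_convolution (ContinuousLinearMap.mul ℝ ℝ) (hfint j)
  obtain ⟨φ, hφm, hφ1, hφs, hφh⟩ := aux_select n h hmeas
  have hi : ∀ j, Integrable (fun t => φ j t * h j t) := fun j =>
    Integrable.bdd_mul (c := 1) (hhint j) (hφm j).aestronglyMeasurable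
      (ae_of_all _ fun t => hφ1 j t)
  simp_rw [hh, ← hφh]
  rw [← ofReal_integral_eq_lintegral_ofReal (integrable_finsetSum _ fun j _ => hi j)]
  swap
  · refine ae_of_all _ fun t => ?_
    simp only [hφh]
    exact Real.iSup_nonneg fun j => abs_nonneg _
  refine ENNReal.ofReal_le_ofReal ?_
  rw [integral_finsetSum _ fun j _ => hi j]
  let r' : ℝ → ℝ := fun x => - r (-x)
  have hr' : ContDiff ℝ (⊤ : ℕ∞) r' := (hr.comp contDiff_neg).neg
  have hc' : HasCompactSupport r' := (hc.comp_homeomorph (Homeomorph.neg ℝ)).neg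
  have hr'd : ∀ x, deriv r' x = deriv r (-x) := fun x => by
    simp only [r', deriv.fun_neg]
    rw [deriv_comp_neg]; simp
  have hr'int : Integrable r' := hrint.comp_neg.neg
  have hd'int : Integrable (fun x => deriv r (-x)) := hdint.comp_neg
  let ψ : Fin (n + 1) → ℝ → ℝ := fun j u => ∫ s, r' s * φ j (u - s)
  have hψd : ∀ j u, deriv (ψ j) u = ∫ s, deriv r (-s) * φ j (u - s) := fun j u => by
    simp_rw [← hr'd]
    exact aux_deriv r' (φ j) hr' hc' (hφm j) 1 (hφ1 j) u
  have hbd : ∀ (q : ℝ → ℝ) j u, Integrable q → |∫ s, q s * φ j (u - s)| ≤ ∫ s, |q s| := by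
    intro q j u hq
    rw [← Real.norm_eq_abs]
    refine norm_integral_le_of_norm_le hq.abs (ae_of_all _ fun s => ?_)
    rw [Real.norm_eq_abs, abs_mul]
    exact mul_le_of_le_one_right (abs_nonneg _) (hφ1 _ _)
  have hsum : ∀ u, ∑ j, |ψ j u| ≤ 1 := by
    intro u
    have hii : ∀ j, Integrable (fun s => r (-s) * |φ j (u - s)|) := fun j =>
      Integrable.mul_bdd (c := 1) hrint.comp_neg
        (((hφm j).comp (measurable_const.sub measurable_id)).abs).aestronglyMeasurable
        (ae_of_all _ fun s => by simpa using hφ1 j (u - s))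
    calc ∑ j, |ψ j u| ≤ ∑ j, ∫ s, r (-s) * |φ j (u - s)| := by
          refine Finset.sum_le_sum fun j _ => ?_
          rw [← Real.norm_eq_abs]
          refine norm_integral_le_of_norm_le (hii j) (ae_of_all _ fun s => ?_)
          simp only [r', Real.norm_eq_abs, abs_mul, abs_neg, abs_of_nonneg (hpos _)]
          exact le_rfl
      _ = ∫ s, ∑ j, r (-s) * |φ j (u - s)| := (integral_finsetSum _ fun j _ => hii j).symm
      _ ≤ ∫ s, r (-s) := by
          refine integral_mono (integrable_finsetSum _ fun j _ => hii j) hrint.comp_neg fun s => ?_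
          simp only [← Finset.mul_sum]
          exact mul_le_of_le_one_right (hpos _) (hφs _)
      _ = 1 := by rw [integral_neg_eq_self r volume, hint]
  have := hdual ψ
    (fun j => (aux_smooth r' (φ j) hr' hc' (hφm j) 1 (hφ1 j)).of_le (by exact_mod_cast le_top))
    (fun j => ⟨_, fun u => hbd r' j u hr'int⟩)
    (fun j => ⟨_, fun u => by rw [hψd]; exact hbd _ j u hd'int⟩) 1 hsum
  rw [mul_one] at this
  refine le_trans (le_of_eq ?_) this
  refine Finset.sum_congr rfl fun j _ => ?_
  simp_rw [hψd]
  exact aux_fubini (deriv r) (f j) (φ j) hdint (hfint j) (hφm j) (hφ1 j)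

/-- if bounded measurable functions `f₀,…,fₙ` vanishing outside `[0,T]`
satisfy the duality bound `Σ_k ∫ f_k ψ'_k ≤ C sup Σ_k |ψ_k|` over all bounded `C¹` test
functions with bounded derivatives, then their mollifications `f_k^m = ρ_m * f_k` are
smooth and satisfy `∫ max_k |(f_k^m)'(t)| dt ≤ C`. -/
theorem mollified_uniform_variation_bound
    (T : ℝ) (hT : 0 < T)
    (ρ : ℝ → ℝ) (hρsm : ContDiff ℝ (⊤ : ℕ∞) ρ) (hρpos : ∀ x, 0 ≤ ρ x)
    (hρsupp : ∀ x, x ∉ Icc (-1 : ℝ) 1 → ρ x = 0) (hρint : (∫ x, ρ x) = 1)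
    (n : ℕ) (C : ℝ) (hC : 0 < C)
    (f : Fin (n + 1) → ℝ → ℝ)
    (hfmeas : ∀ j, Measurable (f j))
    (hfbdd : ∀ j, ∃ M, ∀ t, |f j t| ≤ M)
    (hfsupp : ∀ j, ∀ t, t ∉ Icc (0:ℝ) T → f j t = 0)
    (hdual : ∀ ψ : Fin (n + 1) → ℝ → ℝ, (∀ j, ContDiff ℝ 1 (ψ j)) →
      (∀ j, ∃ M, ∀ t, |ψ j t| ≤ M) → (∀ j, ∃ M, ∀ t, |deriv (ψ j) t| ≤ M) →
      ∀ Mψ : ℝ, (∀ t, (∑ j : Fin (n + 1), |ψ j t|) ≤ Mψ) →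
      (∑ j : Fin (n + 1), ∫ t, f j t * deriv (ψ j) t) ≤ C * Mψ)
    (m : ℕ) (hm : 1 ≤ m) :
    (∀ j, ContDiff ℝ (⊤ : ℕ∞) (fun t => ∫ s, ((m : ℝ) * ρ ((m : ℝ) * s)) * f j (t - s))) ∧
    (∫⁻ t, ENNReal.ofReal (⨆ j : Fin (n + 1),
        |deriv (fun t => ∫ s, ((m : ℝ) * ρ ((m : ℝ) * s)) * f j (t - s)) t|))
      ≤ ENNReal.ofReal C := by
  have hm0 : (0:ℝ) < m := by exact_mod_cast hm
  have hr : ContDiff ℝ (⊤ : ℕ∞) (fun s : ℝ => (m : ℝ) * ρ ((m : ℝ) * s)) :=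
    contDiff_const.mul (hρsm.comp (contDiff_const.mul contDiff_id))
  have hc : HasCompactSupport (fun s : ℝ => (m : ℝ) * ρ ((m : ℝ) * s)) := by
    refine HasCompactSupport.intro (isCompact_Icc (a := (-1:ℝ)) (b := 1)) fun x hx => ?_
    have hm1 : (1:ℝ) ≤ m := by exact_mod_cast hm
    rw [hρsupp, mul_zero]
    intro hx'
    apply hx
    rw [mem_Icc] at hx' ⊢
    constructor
    · by_contra hlt
      push Not at hlt
      nlinarith [hx'.1]
    · by_contra hlt
      push Not at hlt
      nlinarith [hx'.2]
  refine ⟨fun j => ?_, ?_⟩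
  · obtain ⟨M, hM⟩ := hfbdd j
    exact aux_smooth _ (f j) hr hc (hfmeas j) M hM
  · refine aux_main _ hr hc (fun x => mul_nonneg hm0.le (hρpos _)) ?_ n C f hfmeas hfbdd ?_ hdual
    · rw [integral_const_mul, Measure.integral_comp_mul_left, hρint, abs_of_pos (inv_pos.2 hm0)]
      simp [hm0.ne']
    · intro j
      obtain ⟨M, hM⟩ := hfbdd j
      have h1 : IntegrableOn (f j) (Icc 0 T) :=
        (aux_locInt (f j) (hfmeas j) M hM).integrableOn_isCompact isCompact_Icc
      refine (integrableOn_iff_integrable_of_support_subset fun t ht => ?_).1 h1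
      by_contra hn
      exact ht (hfsupp j t hn)

end
end

section
/- Let P̄ > 0, c > 0 and an integer n ≥ 1 be given, and let Φ : [0,P̄] → ℝ be nondecreasing with Φ(q) − Φ(p) ≥ c(q − p) for all 0 ≤ p ≤ q ≤ P̄. Set x_k = Φ(kP̄/n) for k = 0, …, n, define Θₙ(y) = (P̄/n) Σ_{k=0}^{n−1} min( (y − x_k)₊ / (x_{k+1} − x_k), 1 ), and define P(y) = min( inf{ p ∈ [0,P̄] : Φ(p) ≥ y }, P̄ ) with the convention inf ∅ = +∞. Then for every y ∈ ℝ one has |Θₙ(y) − P(y)| ≤ P̄/n. -/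
open MeasureTheory Set Filter
open scoped Classical

noncomputable section

/-- the discretized price `Θₙ(y)` approximates the exact price `P(y)`
within `P̄/n`, when the supply curve `Φ` is nondecreasing with slope at least `c`. -/
theorem discretized_price_error
    (Pbar c : ℝ) (hPbar : 0 < Pbar) (hc : 0 < c) (n : ℕ) (hn : 1 ≤ n)
    (Φ : ℝ → ℝ) (hΦmono : MonotoneOn Φ (Icc 0 Pbar))
    (hΦslope : ∀ p q : ℝ, 0 ≤ p → p ≤ q → q ≤ Pbar → c * (q - p) ≤ Φ q - Φ p)
    (y : ℝ) :
    |(Pbar / n) * (∑ j ∈ Finset.range n,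
        min (max (y - Φ ((j : ℝ) * Pbar / n)) 0
              / (Φ (((j : ℝ) + 1) * Pbar / n) - Φ ((j : ℝ) * Pbar / n))) 1)
      - (if ({p : ℝ | p ∈ Icc 0 Pbar ∧ y ≤ Φ p}).Nonempty
          then min (sInf {p : ℝ | p ∈ Icc 0 Pbar ∧ y ≤ Φ p}) Pbar else Pbar)|
      ≤ Pbar / n := by
  have hn0 : (0:ℝ) < n := by exact_mod_cast hn
  set P : ℝ := (if ({p : ℝ | p ∈ Icc 0 Pbar ∧ y ≤ Φ p}).Nonempty
          then min (sInf {p : ℝ | p ∈ Icc 0 Pbar ∧ y ≤ Φ p}) Pbar else Pbar) with hP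
  have hbdd : BddBelow {p : ℝ | p ∈ Icc 0 Pbar ∧ y ≤ Φ p} := ⟨0, fun p hp => hp.1.1⟩
  have hP0 : 0 ≤ P := by
    rw [hP]; split_ifs with h
    · exact le_min (le_csInf h fun p hp => hp.1.1) hPbar.le
    · exact hPbar.le
  have hP1 : P ≤ Pbar := by
    rw [hP]; split_ifs with h
    · exact min_le_right _ _
    · exact le_rfl
  have hPle : ∀ p, 0 ≤ p → p ≤ Pbar → y ≤ Φ p → P ≤ p := by
    intro p h0 h1 hy
    have hm : p ∈ {p : ℝ | p ∈ Icc 0 Pbar ∧ y ≤ Φ p} := ⟨⟨h0, h1⟩, hy⟩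
    rw [hP, if_pos ⟨p, hm⟩]
    exact (min_le_left _ _).trans (csInf_le hbdd hm)
  have hleP : ∀ p, 0 ≤ p → p ≤ Pbar → Φ p < y → p ≤ P := by
    intro p h0 h1 hy
    rw [hP]; split_ifs with h
    · refine le_min (le_csInf h ?_) h1
      intro q hq
      by_contra hlt
      have := hΦmono hq.1 ⟨h0, h1⟩ (not_le.mp hlt).le
      linarith [hq.2]
    · exact h1
  clear_value P
  set h : ℝ := Pbar / n with hh
  have hpos : 0 < h := div_pos hPbar hn0
  have hnh : (n:ℝ) * h = Pbar := by rw [hh]; field_simp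
  have key : ∀ m : ℕ, m ≤ n →
      (Φ (m * h) < y ∧ h * (∑ j ∈ Finset.range m,
        min (max (y - Φ ((j : ℝ) * h)) 0
              / (Φ (((j : ℝ) + 1) * h) - Φ ((j : ℝ) * h))) 1) = m * h) ∨
      (y ≤ Φ (m * h) ∧ |h * (∑ j ∈ Finset.range m,
        min (max (y - Φ ((j : ℝ) * h)) 0
              / (Φ (((j : ℝ) + 1) * h) - Φ ((j : ℝ) * h))) 1) - P| ≤ h) := by
    intro m
    induction m with
    | zero =>
      intro _
      rcases lt_or_ge (Φ (((0:ℕ):ℝ) * h)) y with h1 | h1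
      · left; exact ⟨h1, by simp⟩
      · right
        refine ⟨h1, ?_⟩
        have : P ≤ 0 := hPle 0 le_rfl hPbar.le (by simpa using h1)
        have : P = 0 := le_antisymm this hP0
        simp [this, hpos.le]
    | succ m ih =>
      intro hm
      have hmn : ((m:ℝ) + 1) ≤ n := by exact_mod_cast hm
      have ha : 0 ≤ (m:ℝ) * h := by positivity
      have hab : (m:ℝ) * h < ((m:ℝ) + 1) * h := by nlinarith
      have hb : ((m:ℝ) + 1) * h ≤ Pbar := by rw [← hnh]; gcongr
      have hD : 0 < Φ (((m:ℝ) + 1) * h) - Φ ((m:ℝ) * h) := by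
        have := hΦslope _ _ ha hab.le hb
        have : 0 < c * (((m:ℝ) + 1) * h - (m:ℝ) * h) := mul_pos hc (by linarith)
        linarith
      rw [Finset.sum_range_succ, mul_add]
      push_cast
      rcases ih (by omega) with ⟨h1, h2⟩ | ⟨h1, h2⟩
      · rw [h2]
        have hPa := hleP _ ha (hab.le.trans hb) h1
        rcases lt_or_ge (Φ (((m:ℝ) + 1) * h)) y with h3 | h3
        · left
          refine ⟨h3, ?_⟩
          rw [min_eq_right]
          · ring
          · rw [le_div_iff₀ hD]
            exact le_max_of_le_left (by linarith)
        · right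
          refine ⟨h3, ?_⟩
          have hPb := hPle _ (ha.trans hab.le) hb h3
          set t := min (max (y - Φ ((m : ℝ) * h)) 0
              / (Φ (((m : ℝ) + 1) * h) - Φ ((m : ℝ) * h))) 1 with ht
          have t1 : t ≤ 1 := min_le_right _ _
          have t0 : 0 ≤ t := le_min (div_nonneg (le_max_right _ _) hD.le) zero_le_one
          have := mul_nonneg hpos.le t0
          have : h * t ≤ h := by nlinarith
          rw [abs_le]
          constructor <;> linarith
      · right
        refine ⟨by linarith, ?_⟩
        rw [max_eq_right (by linarith : y - Φ ((m : ℝ) * h) ≤ 0)]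
        simpa using h2
  simp only [mul_div_assoc, ← hh]
  rcases key n le_rfl with ⟨h1, h2⟩ | ⟨_, h2⟩
  · rw [h2, hnh]
    rw [hnh] at h1
    have := hleP Pbar hPbar.le le_rfl h1
    have : P = Pbar := le_antisymm hP1 this
    rw [this]; simpa using hpos.le
  · exact h2

end
end

section
/- Let ω₁ and ω₂ be finite positive Borel measures on [0,∞), let R₁, R₂, D ∈ ℝ, and let P₁ > P₂ ≥ 0 satisfy: ∫ F(P₁ − x) ω₁(dx) ≤ (D − R₁)₊ − F₀(P₁), ∫ F(P₂ − x) ω₂(dx) = (D − R₂)₊ − F₀(P₂), and D − R₁ > 0. Then ∫ (G(P₁ − x) − G(P₂ − x)) ω₁(dx) − ∫ (G(P₁ − x) − G(P₂ − x)) ω₂(dx) + (P₁ − P₂)(R₁ − R₂) ≤ −c (P₁ − P₂)². -/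
open MeasureTheory Set Filter
open scoped Classical

noncomputable section

/-- the antimonotonicity estimate used for uniqueness of the equilibrium
price: under the market-clearing conditions at prices `P₁ > P₂`, the gain difference is
dominated by `−c (P₁ − P₂)²`. -/
theorem antimonotonicity_estimate
    (F : ℝ → ℝ) (hFmono : Monotone F) (hFrange : ∀ y, F y ∈ Icc (0:ℝ) 1)
    (G : ℝ → ℝ) (hG : ∀ x, G x = ∫ z in (0:ℝ)..x, F z)
    (F₀ : ℝ → ℝ) (c : ℝ) (hc : 0 < c) (hF₀zero : F₀ 0 = 0)
    (hF₀mono : MonotoneOn F₀ (Ici 0))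
    (hF₀slope : ∀ p h : ℝ, 0 ≤ p → 0 ≤ h → c * h ≤ F₀ (p + h) - F₀ p)
    (ω₁ ω₂ : Measure ℝ) (hω₁fin : IsFiniteMeasure ω₁) (hω₂fin : IsFiniteMeasure ω₂)
    (hω₁supp : ω₁ (Ici (0:ℝ))ᶜ = 0) (hω₂supp : ω₂ (Ici (0:ℝ))ᶜ = 0)
    (R₁ R₂ D P₁ P₂ : ℝ) (hP₂ : 0 ≤ P₂) (hP : P₂ < P₁)
    (h₁ : (∫ x, F (P₁ - x) ∂ω₁) ≤ max (D - R₁) 0 - F₀ P₁)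
    (h₂ : (∫ x, F (P₂ - x) ∂ω₂) = max (D - R₂) 0 - F₀ P₂)
    (h₃ : 0 < D - R₁) :
    (∫ x, (G (P₁ - x) - G (P₂ - x)) ∂ω₁) - (∫ x, (G (P₁ - x) - G (P₂ - x)) ∂ω₂)
      + (P₁ - P₂) * (R₁ - R₂) ≤ -c * (P₁ - P₂) ^ 2 := by
  have hint : ∀ a b : ℝ, IntervalIntegrable F volume a b := fun a b => hFmono.intervalIntegrable
  have hGc : Continuous G := by
    have : G = fun x => ∫ z in (0:ℝ)..x, F z := funext hG
    rw [this]
    exact intervalIntegral.continuous_primitive hint 0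
  have hd : ∀ x, G (P₁ - x) - G (P₂ - x) = ∫ z in (P₂ - x)..(P₁ - x), F z := by
    intro x
    rw [hG, hG, intervalIntegral.integral_interval_sub_left (hint _ _) (hint _ _)]
  have hle : ∀ x, P₂ - x ≤ P₁ - x := fun x => by linarith
  have hup : ∀ x, G (P₁ - x) - G (P₂ - x) ≤ (P₁ - P₂) * F (P₁ - x) := by
    intro x
    rw [hd]
    have := intervalIntegral.integral_mono_on (hle x) (hint _ _)
      (intervalIntegrable_const (c := F (P₁ - x))) (fun z hz => hFmono hz.2)
    simpa using this
  have hlo : ∀ x, (P₁ - P₂) * F (P₂ - x) ≤ G (P₁ - x) - G (P₂ - x) := by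
    intro x
    rw [hd]
    have := intervalIntegral.integral_mono_on (hle x)
      (intervalIntegrable_const (c := F (P₂ - x))) (hint _ _) (fun z hz => hFmono hz.1)
    simpa using this
  have hFi : ∀ (ω : Measure ℝ) [IsFiniteMeasure ω] (P : ℝ),
      Integrable (fun x => F (P - x)) ω := by
    intro ω _ P
    refine Integrable.of_bound (C := 1)
      (hFmono.measurable.comp (measurable_const.sub measurable_id)).aestronglyMeasurable ?_
    refine Eventually.of_forall fun x => ?_
    rw [Real.norm_eq_abs, abs_of_nonneg (hFrange _).1]
    exact (hFrange _).2
  have hGi : ∀ (ω : Measure ℝ) [IsFiniteMeasure ω],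
      Integrable (fun x => G (P₁ - x) - G (P₂ - x)) ω := by
    intro ω _
    refine Integrable.of_bound (C := P₁ - P₂)
      (by fun_prop : Continuous fun x => G (P₁ - x) - G (P₂ - x)).aestronglyMeasurable ?_
    refine Eventually.of_forall fun x => ?_
    have a1 := hup x
    have a2 := hlo x
    have b1 := (hFrange (P₁ - x)).2
    have b2 := (hFrange (P₂ - x)).1
    rw [Real.norm_eq_abs, abs_of_nonneg (by nlinarith)]
    nlinarith
  have i1 := integral_mono (hGi ω₁) ((hFi ω₁ P₁).const_mul (P₁ - P₂)) hup
  have i2 := integral_mono ((hFi ω₂ P₂).const_mul (P₁ - P₂)) (hGi ω₂) hlo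
  rw [integral_const_mul] at i1 i2
  rw [max_eq_left h₃.le] at h₁
  have hs := hF₀slope P₂ (P₁ - P₂) hP₂ (by linarith)
  rw [add_sub_cancel] at hs
  have hm := le_max_left (D - R₂) 0
  have hpos : 0 ≤ P₁ - P₂ := by linarith
  have k1 := mul_le_mul_of_nonneg_left h₁ hpos
  have k2 : (P₁ - P₂) * (D - R₂ - F₀ P₂) ≤ (P₁ - P₂) * ∫ x, F (P₂ - x) ∂ω₂ :=
    mul_le_mul_of_nonneg_left (by linarith) hpos
  have k3 := mul_le_mul_of_nonneg_left hs hpos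
  linarith

end
end
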